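/- arXiv:2507.09181 — 2 statements merged into one kernel-verified Lean document; each statement's English description precedes it below -/
import Mathlib

section
/- Let (Ω, F, P) be a nonatomic probability space, let Φ be an Orlicz function, and let H_Φ be the associated Orlicz premium on L∞₊. Assume there exist u₁ < 1 with Φ(u₁) < 1 and u₂ > 1 with Φ(u₂) < +∞. If H_Φ is convex (H_Φ(αX + (1−α)Y) ≤ α·H_Φ(X) + (1−α)·H_Φ(Y) for all X, Y ∈ L∞₊ and α ∈ (0,1)), then Φ is convex on the set where it is finite. -/
open MeasureTheory Filter Set
open scoped ENNReal

noncomputable section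

variable {Ω : Type*} [MeasurableSpace Ω]

/-- `X` belongs to `L^∞_+(P)`: it is measurable, `P`-a.s. nonnegative and
`P`-essentially bounded. -/
def MemLinftyPlus (P : Measure Ω) (X : Ω → ℝ) : Prop :=
  Measurable X ∧ (∀ᵐ ω ∂P, 0 ≤ X ω) ∧ ∃ C : ℝ, ∀ᵐ ω ∂P, X ω ≤ C

/-- `X` belongs to `L^∞_++(P)`: it is measurable, bounded away from `0` and
`P`-essentially bounded. -/
def MemLinftyPlusPlus (P : Measure Ω) (X : Ω → ℝ) : Prop :=
  Measurable X ∧ (∃ c : ℝ, 0 < c ∧ ∀ᵐ ω ∂P, c ≤ X ω) ∧ ∃ C : ℝ, ∀ᵐ ω ∂P, X ω ≤ C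

/-- An Orlicz function `Φ : [0,∞) → ℝ ∪ {±∞}`: nondecreasing, left-continuous,
`Φ(x) > -∞` for `x > 0`, `Φ(x) ≤ 1` for `0 ≤ x ≤ 1` and `Φ(x) > 1` for `x > 1`. -/
structure IsOrliczFunction (Φ : ℝ → EReal) : Prop where
  ne_bot : ∀ x : ℝ, 0 < x → Φ x ≠ ⊥
  le_one : ∀ x : ℝ, 0 ≤ x → x ≤ 1 → Φ x ≤ 1
  one_lt : ∀ x : ℝ, 1 < x → 1 < Φ x
  mono : ∀ x y : ℝ, 0 ≤ x → x ≤ y → Φ x ≤ Φ y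
  left_cont : ∀ x : ℝ, 0 < x → Φ x = ⨆ y : Set.Ico (0 : ℝ) x, Φ (y : ℝ)

/-- The nonnegative part of an extended real, as an extended nonnegative real. -/
def erealToENNReal (x : EReal) : ℝ≥0∞ :=
  if x = ⊤ then ⊤ else ENNReal.ofReal x.toReal

/-- Expectation of an extended-real-valued function: positive part minus negative part. -/
def eexp (P : Measure Ω) (f : Ω → EReal) : EReal :=
  ((∫⁻ ω, erealToENNReal (f ω) ∂P : ℝ≥0∞) : EReal)
    - ((∫⁻ ω, erealToENNReal (-(f ω)) ∂P : ℝ≥0∞) : EReal)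

/-- The (generalized) Orlicz premium `H_Φ(X) = inf {k > 0 | E[Φ(X/k)] ≤ 1}`, with the
convention `H_Φ(X) = 0` if `Φ(0) = -∞` and `P(X = 0) > 0`. -/
def orliczPremium (P : Measure Ω) (Φ : ℝ → EReal) (X : Ω → ℝ) : ℝ :=
  if Φ 0 = ⊥ ∧ 0 < P {ω | X ω = 0} then 0
  else sInf {k : ℝ | 0 < k ∧ eexp P (fun ω => Φ (X ω / k)) ≤ 1}

/-- Addition on `EReal` with the convention `(-∞) + (+∞) = +∞`. -/
def eadd (a b : EReal) : EReal :=
  if (a = ⊥ ∧ b = ⊤) ∨ (a = ⊤ ∧ b = ⊥) then ⊤ else a + b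

/-- Multiplication on `ℝ≥0∞` with the convention `0 * ∞ = ∞`. -/
def gmulE (a b : ℝ≥0∞) : ℝ≥0∞ :=
  if (a = 0 ∧ b = ⊤) ∨ (a = ⊤ ∧ b = 0) then ⊤ else a * b

/-- events of every probability, real version -/
def AllMass (P : Measure Ω) : Prop :=
  ∀ p : ℝ, 0 ≤ p → p ≤ 1 → ∃ A : Set Ω, MeasurableSet A ∧ P.real A = p

lemma comb_lt (P : Measure Ω) [IsProbabilityMeasure P] (hP : AllMass P) (q : ℝ) (hq0 : 0 < q)
    (hq1 : q ≤ 1)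
    (h : ∀ A B : Set Ω, MeasurableSet A → MeasurableSet B → P.real A < q → P.real B < q →
      P.real (A ∪ B) < q) : False := by
  have h1 : ∀ n : ℕ, ∃ A : Set Ω, MeasurableSet A ∧ P.real A = q - q / (n + 2) := by
    intro n
    have h2 : q / ((n : ℝ) + 2) ≤ q := div_le_self hq0.le (by linarith [(Nat.cast_nonneg n : (0:ℝ) ≤ n)])
    have h3 : 0 ≤ q / ((n : ℝ) + 2) := by positivity
    exact hP _ (by linarith) (by linarith)
  choose A hAm hA using h1
  have hAq : ∀ n, P.real (A n) < q := by
    intro n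
    rw [hA]
    have : 0 < q / ((n : ℝ) + 2) := by positivity
    linarith
  have hacc : ∀ n, MeasurableSet (Set.accumulate A n) ∧ P.real (Set.accumulate A n) < q := by
    intro n
    induction n with
    | zero =>
      have : Set.accumulate A 0 = A 0 := by
        ext ω; simp [Set.mem_accumulate]
      rw [this]; exact ⟨hAm 0, hAq 0⟩
    | succ k ih =>
      rw [Set.accumulate_succ]
      exact ⟨ih.1.union (hAm _), h _ _ ih.1 (hAm _) ih.2 (hAq _)⟩
  have ht : Tendsto (fun i => P.real (Set.accumulate A i)) atTop (nhds (P.real (⋃ i, A i))) := by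
    have := tendsto_measure_iUnion_accumulate (μ := P) (f := A)
    exact (ENNReal.tendsto_toReal (measure_ne_top P _)).comp this
  have hle : P.real (⋃ i, A i) ≤ q := le_of_tendsto' ht fun n => (hacc n).2.le
  have hNm : MeasurableSet (⋃ i, A i) := MeasurableSet.iUnion hAm
  have hge : q ≤ P.real (⋃ i, A i) := by
    have t1 : Tendsto (fun n : ℕ => q - q / ((n : ℝ) + 2)) atTop (nhds (q - 0)) := by
      apply Tendsto.sub tendsto_const_nhds
      apply Tendsto.div_atTop tendsto_const_nhds
      exact tendsto_atTop_add_const_right _ _ tendsto_natCast_atTop_atTop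
    rw [sub_zero] at t1
    refine le_of_tendsto' t1 fun n => ?_
    rw [← hA n]
    exact measureReal_mono (subset_iUnion A n)
  have hd : P.real ((⋃ i, A i) \ A 0) = P.real (⋃ i, A i) - P.real (A 0) :=
    measureReal_diff (subset_iUnion A 0) (hAm 0)
  have h0 : P.real (A 0) = q / 2 := by rw [hA]; norm_num; ring
  have := h (A 0) ((⋃ i, A i) \ A 0) (hAm 0) (hNm.diff (hAm 0)) (hAq 0) (by rw [hd, h0]; linarith)
  rw [union_diff_cancel (subset_iUnion A 0)] at this
  linarith

lemma comb_le (P : Measure Ω) [IsProbabilityMeasure P] (hP : AllMass P) (q : ℝ) (hq0 : 0 < q)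
    (hq1 : q < 1)
    (h : ∀ A B : Set Ω, MeasurableSet A → MeasurableSet B → P.real A ≤ q → P.real B ≤ q →
      P.real (A ∪ B) ≤ q) : False := by
  obtain ⟨A, hAm, hA⟩ := hP q hq0.le hq1.le
  -- nonnull sets disjoint from A have mass > q
  have key : ∀ S, MeasurableSet S → Disjoint S A → 0 < P.real S → q < P.real S := by
    intro S hS hd h0
    by_contra hc
    have h1 := h A S hAm hS hA.le (not_lt.mp hc)
    rw [measureReal_union hd.symm hS] at h1
    linarith
  have ind : ∀ n : ℕ, ∃ D : Set Ω, MeasurableSet D ∧ n * q ≤ P.real D ∧ ∃ m, q < m ∧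
      ∀ E, MeasurableSet E → P.real E < m → Disjoint E A → P.real (E ∩ D) = 0 := by
    intro n
    induction n with
    | zero => exact ⟨∅, MeasurableSet.empty, by simp, q + 1, by linarith, by simp⟩
    | succ n ih =>
      obtain ⟨D, hDm, hD, m, hm, hE⟩ := ih
      obtain ⟨e, he1, he2⟩ := exists_between (lt_min hm (lt_min (show q < 2 * q by linarith) hq1))
      rw [lt_min_iff, lt_min_iff] at he2
      obtain ⟨E, hEm, hEe⟩ := hP e (by linarith) (by linarith)
      have hFpos : 0 < P.real (E \ A) := by
        have := le_measureReal_sdiff (μ := P) (s₁ := E) (s₂ := A)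
        linarith
      have hFle : P.real (E \ A) ≤ e := hEe ▸ measureReal_mono sdiff_subset
      have hFm := hEm.diff hAm
      have hFd : Disjoint (E \ A) A := disjoint_sdiff_left
      have hFq := key _ hFm hFd hFpos
      have hFD := hE _ hFm (by linarith) hFd
      refine ⟨D ∪ (E \ A), hDm.union hFm, ?_, min m (P.real (E \ A)), lt_min hm hFq, ?_⟩
      · have := measureReal_union_add_inter (μ := P) (s := D) (t := E \ A) hFm
        rw [inter_comm] at this
        push_cast
        linarith
      · intro E' hE' hlt hd
        rw [lt_min_iff] at hlt
        have h1 := hE E' hE' hlt.1 hd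
        have h2 : P.real (E' ∩ (E \ A)) = 0 := by
          by_contra hne
          have hpos : 0 < P.real (E' ∩ (E \ A)) := lt_of_le_of_ne measureReal_nonneg (Ne.symm hne)
          have h3 := key _ (hE'.inter hFm) (hd.mono_left inter_subset_left) hpos
          have h4 : 0 < P.real ((E \ A) \ E') := by
            have := le_measureReal_sdiff (μ := P) (s₁ := E \ A) (s₂ := E')
            linarith
          have h5 := key _ (hFm.diff hE') (hFd.mono_left sdiff_subset) h4
          have h6 := measureReal_inter_add_sdiff (μ := P) (s := E \ A) (t := E') hE'
          rw [inter_comm] at h6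
          linarith
        rw [inter_union_distrib_left]
        have := measureReal_union_le (μ := P) (E' ∩ D) (E' ∩ (E \ A))
        exact le_antisymm (by linarith) measureReal_nonneg
  obtain ⟨n, hn⟩ := exists_nat_gt (1 / q)
  obtain ⟨D, -, hD, -⟩ := ind n
  have : P.real D ≤ 1 := measureReal_le_one
  rw [div_lt_iff₀ hq0] at hn
  linarith

lemma small_sets (P : Measure Ω) [IsProbabilityMeasure P] (hP : AllMass P) (η : ℝ) (hη : 0 < η) :
    ∃ A B : Set Ω, MeasurableSet A ∧ MeasurableSet B ∧ Disjoint A B ∧ 0 < P.real A ∧ 0 < P.real B ∧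
      P.real A + P.real B ≤ η := by
  set m := min η 1 with hm
  have hm0 : 0 < m := lt_min hη one_pos
  have hm1 : m ≤ 1 := min_le_right _ _
  have hm2 : m ≤ η := min_le_left _ _
  obtain ⟨A, hAm, hA⟩ := hP (m / 2) (by linarith) (by linarith)
  obtain ⟨B, hBm, hB⟩ := hP (m / 4) (by linarith) (by linarith)
  refine ⟨A \ B, B, hAm.diff hBm, hBm, disjoint_sdiff_left, ?_, by linarith, ?_⟩
  · have := le_measureReal_sdiff (μ := P) (s₁ := A) (s₂ := B)
    linarith
  · have : P.real (A \ B) ≤ P.real A := measureReal_mono sdiff_subset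
    linarith

/-- The real-valued core of the problem: `f = Φ - 1` on the finite domain `D`. -/
structure OCore (P : Measure Ω) (f : ℝ → ℝ) (D : Set ℝ) : Prop where
  mass : AllMass P
  nonneg : ∀ x ∈ D, 0 ≤ x
  down : ∀ x y, 0 ≤ x → x ≤ y → y ∈ D → x ∈ D
  mono : ∀ x y, 0 ≤ x → x ≤ y → y ∈ D → f x ≤ f y
  lc : ∀ x ∈ D, 0 < x → ∀ ε > 0, ∃ y, 0 ≤ y ∧ y < x ∧ f x - ε < f y
  np : ∀ x, 0 ≤ x → x ≤ 1 → f x ≤ 0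
  pos : ∀ x ∈ D, 1 < x → 0 < f x
  exu1 : ∃ u, 0 ≤ u ∧ u < 1 ∧ f u < 0
  exu2 : ∃ u ∈ D, 1 < u
  acc : ∀ A B : Set Ω, MeasurableSet A → MeasurableSet B → Disjoint A B → ∀ a, 0 < a → a < 1 →
    ∀ x₁ ∈ D, ∀ x₂ ∈ D, ∀ x₃ ∈ D, ∀ y₁ ∈ D, ∀ y₂ ∈ D, ∀ y₃ ∈ D,
    P.real A * f x₁ + P.real B * f x₂ + (1 - P.real A - P.real B) * f x₃ ≤ 0 →
    P.real A * f y₁ + P.real B * f y₂ + (1 - P.real A - P.real B) * f y₃ ≤ 0 →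
    P.real A * f (a * x₁ + (1 - a) * y₁) + P.real B * f (a * x₂ + (1 - a) * y₂)
      + (1 - P.real A - P.real B) * f (a * x₃ + (1 - a) * y₃) ≤ 0

lemma mbound (p M x : ℝ) (hp : 0 < p) (h : -M ≤ x ∧ x ≤ M) : -(p * M) ≤ p * x ∧ p * x ≤ p * M := by
  have h1 := mul_le_mul_of_nonneg_left h.1 hp.le
  have h2 := mul_le_mul_of_nonneg_left h.2 hp.le
  exact ⟨by linarith, h2⟩

namespace OCore

variable {P : Measure Ω} {f : ℝ → ℝ} {D : Set ℝ}

/-- right continuity of `f` at `c` -/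
def RC (f : ℝ → ℝ) (D : Set ℝ) (c : ℝ) : Prop := ∀ ε > 0, ∃ y ∈ D, c < y ∧ f y < f c + ε

lemma one_mem (h : OCore P f D) : (1 : ℝ) ∈ D := by
  obtain ⟨u, hu, h1⟩ := h.exu2
  exact h.down 1 u zero_le_one h1.le hu

lemma acc2 (h : OCore P f D) (p : ℝ) (hp0 : 0 ≤ p) (hp1 : p ≤ 1) (a : ℝ) (ha0 : 0 < a) (ha1 : a < 1)
    (x₁ x₂ y₁ y₂ : ℝ) (hx₁ : x₁ ∈ D) (hx₂ : x₂ ∈ D) (hy₁ : y₁ ∈ D) (hy₂ : y₂ ∈ D)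
    (hx : p * f x₁ + (1 - p) * f x₂ ≤ 0) (hy : p * f y₁ + (1 - p) * f y₂ ≤ 0) :
    p * f (a * x₁ + (1 - a) * y₁) + (1 - p) * f (a * x₂ + (1 - a) * y₂) ≤ 0 := by
  obtain ⟨A, hAm, hA⟩ := h.mass p hp0 hp1
  have := h.acc A ∅ hAm MeasurableSet.empty (by simp) a ha0 ha1 x₁ hx₁ x₂ hx₂ x₂ hx₂ y₁ hy₁ y₂ hy₂
    y₂ hy₂ (by simpa [hA] using hx) (by simpa [hA] using hy)
  simpa [hA] using this

lemma f_one [IsProbabilityMeasure P] (h : OCore P f D) : f 1 = 0 := by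
  by_contra hne
  have hα : f 1 < 0 := lt_of_le_of_ne (h.np 1 zero_le_one le_rfl) hne
  set α := f 1 with hαdef
  obtain ⟨u, huD, hu1⟩ := h.exu2
  -- the union property
  have hun : ∀ A B : Set Ω, MeasurableSet A → MeasurableSet B →
      (∃ y ∈ D, 1 < y ∧ P.real A * f y + (1 - P.real A) * α ≤ 0) →
      (∃ y ∈ D, 1 < y ∧ P.real B * f y + (1 - P.real B) * α ≤ 0) →
      (∃ y ∈ D, 1 < y ∧ P.real (A ∪ B) * f y + (1 - P.real (A ∪ B)) * α ≤ 0) := by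
    rintro A B hA hB ⟨y, hyD, hy1, hy⟩ ⟨z, hzD, hz1, hz⟩
    have hwl : 1 < min y z := lt_min hy1 hz1
    have hwD : min y z ∈ D := h.down _ y (by linarith) (min_le_left _ _) hyD
    set w := min y z with hw
    have h1 : f w ≤ f y := h.mono _ _ (by linarith) (min_le_left _ _) hyD
    have h2 : f w ≤ f z := h.mono _ _ (by linarith) (min_le_right _ _) hzD
    have hPA : 0 ≤ P.real A := measureReal_nonneg
    have hPB : P.real (B \ A) ≤ P.real B := measureReal_mono sdiff_subset
    have hPB0 : 0 ≤ P.real (B \ A) := measureReal_nonneg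
    have hfw := h.pos w hwD hwl
    have hd : Disjoint A (B \ A) := disjoint_sdiff_right
    have h1D := h.one_mem
    have key := h.acc A (B \ A) hA (hB.diff hA) hd (1/2) (by norm_num) (by norm_num) w hwD 1 h1D 1 h1D
      1 h1D w hwD 1 h1D (by rw [← hαdef]; nlinarith) (by rw [← hαdef]; nlinarith)
    refine ⟨(1/2) * w + (1 - 1/2) * 1, h.down _ w (by linarith) (by linarith) hwD, by linarith, ?_⟩
    have hu : P.real (A ∪ B) = P.real A + P.real (B \ A) := by
      rw [← measureReal_union hd (hB.diff hA), union_sdiff_self]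
    rw [hu]
    have e1 : (1/2 : ℝ) * 1 + (1 - 1/2) * w = (1/2) * w + (1 - 1/2) * 1 := by ring
    have e2 : (1/2 : ℝ) * 1 + (1 - 1/2) * 1 = 1 := by ring
    rw [e1, e2, ← hαdef] at key
    linarith
  set S : Set ℝ := f '' {y | y ∈ D ∧ 1 < y} with hS
  have hSne : S.Nonempty := ⟨f u, u, ⟨huD, hu1⟩, rfl⟩
  have hSpos : ∀ s ∈ S, 0 < s := by
    rintro _ ⟨y, ⟨hy, hy1⟩, rfl⟩; exact h.pos y hy hy1
  have hSb : BddBelow S := ⟨0, fun s hs => (hSpos s hs).le⟩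
  set β := sInf S with hβ
  have hβ0 : 0 ≤ β := le_csInf hSne fun s hs => (hSpos s hs).le
  have hβle : ∀ y ∈ D, 1 < y → β ≤ f y := fun y hy hy1 => csInf_le hSb ⟨y, ⟨hy, hy1⟩, rfl⟩
  have hpos : 0 < β - α := by linarith
  set q := -α / (β - α) with hq
  have hq0 : 0 < q := div_pos (by linarith) hpos
  have hqe : q * (β - α) = -α := by rw [hq]; field_simp
  by_cases hatt : β ∈ S
  · obtain ⟨y, ⟨hy, hy1⟩, hyβ⟩ := hatt
    have hβpos : 0 < β := by rw [← hyβ]; exact h.pos y hy hy1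
    have hq1 : q < 1 := by rw [hq, div_lt_one hpos]; linarith
    refine comb_le P h.mass q hq0 hq1 fun A B hA hB hAq hBq => ?_
    obtain ⟨z, hz, hz1, hzz⟩ := hun A B hA hB ⟨y, hy, hy1, by rw [hyβ]; nlinarith⟩
      ⟨y, hy, hy1, by rw [hyβ]; nlinarith⟩
    have h1 := hβle z hz hz1
    have h2 : 0 ≤ P.real (A ∪ B) := measureReal_nonneg
    by_contra hc
    nlinarith
  · have hβlt : ∀ y ∈ D, 1 < y → β < f y := fun y hy hy1 =>
      lt_of_le_of_ne (hβle y hy hy1) fun he => hatt ⟨y, ⟨hy, hy1⟩, he.symm⟩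
    have hq1 : q ≤ 1 := by rw [hq, div_le_one hpos]; linarith
    have hin : ∀ A : Set Ω, P.real A < q →
        ∃ y ∈ D, 1 < y ∧ P.real A * f y + (1 - P.real A) * α ≤ 0 := by
      intro A hA
      have h0 : 0 ≤ P.real A := measureReal_nonneg
      have h1 : P.real A ≤ 1 := measureReal_le_one
      have hη : 0 < (q - P.real A) * (β - α) := mul_pos (by linarith) hpos
      obtain ⟨_, ⟨y, ⟨hy, hy1⟩, rfl⟩, hlt⟩ := exists_lt_of_csInf_lt hSne
        (show sInf S < β + (q - P.real A) * (β - α) by linarith)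
      refine ⟨y, hy, hy1, ?_⟩
      have h3 : P.real A * (f y - β) ≤ 1 * (f y - β) :=
        mul_le_mul_of_nonneg_right h1 (by linarith [hβle y hy hy1])
      nlinarith
    refine comb_lt P h.mass q hq0 hq1 fun A B hA hB hAq hBq => ?_
    obtain ⟨z, hz, hz1, hzz⟩ := hun A B hA hB (hin A hAq) (hin B hBq)
    have h1 := hβlt z hz hz1
    by_contra hc
    have h4 : 0 < P.real (A ∪ B) := by linarith
    have h5 : q * (β - α) ≤ P.real (A ∪ B) * (β - α) :=
      mul_le_mul_of_nonneg_right (by linarith) hpos.le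
    have h6 : P.real (A ∪ B) * β < P.real (A ∪ B) * f z := mul_lt_mul_of_pos_left h1 h4
    nlinarith

lemma shrink [IsProbabilityMeasure P] (h : OCore P f D) :
    ∃ p u v : ℝ, 0 < p ∧ p ≤ 1 ∧ 0 ≤ u ∧ u < 1 ∧ v ∈ D ∧ 1 < v ∧ ∀ a, 0 < a → a < 1 →
      p * f (a * v + (1 - a)) + (1 - p) * f (a * u + (1 - a)) ≤ 0 := by
  obtain ⟨u, hu0, hu1, hfu⟩ := h.exu1
  obtain ⟨v, hvD, hv1⟩ := h.exu2
  have hfv := h.pos v hvD hv1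
  have hpos : 0 < f v - f u := by linarith
  have hp0 : 0 < - f u / (f v - f u) := div_pos (by linarith) hpos
  have hp1 : - f u / (f v - f u) ≤ 1 := by rw [div_le_one hpos]; linarith
  have hpe : - f u / (f v - f u) * (f v - f u) = - f u := by field_simp
  refine ⟨_, u, v, hp0, hp1, hu0, hu1, hvD, hv1, fun a ha0 ha1 => ?_⟩
  have h1 := h.one_mem
  have := h.acc2 _ hp0.le hp1 a ha0 ha1 v u 1 1 hvD (h.down u v hu0 (by linarith) hvD) h1 h1
    (by linarith) (by rw [h.f_one]; simp)
  simpa using this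

lemma rc_one [IsProbabilityMeasure P] (h : OCore P f D) : RC f D 1 := by
  obtain ⟨p, u, v, hp0, hp1, hu0, hu1, hvD, hv1, hk⟩ := h.shrink
  intro ε hε
  rw [h.f_one]
  obtain ⟨y, hy0, hy1, hy⟩ := h.lc 1 h.one_mem one_pos (p * ε) (by positivity)
  rw [h.f_one] at hy
  have ha0 : 0 < (1 - y) / 2 := by linarith
  have ha1 : (1 - y) / 2 < 1 := by linarith
  have := hk _ ha0 ha1
  set a := (1 - y) / 2 with ha
  have h1 : f y ≤ f (a * u + (1 - a)) :=
    h.mono _ _ hy0 (by nlinarith) (h.down _ 1 (by nlinarith) (by nlinarith) h.one_mem)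
  have h2 : f (a * u + (1 - a)) ≤ 0 := h.np _ (by nlinarith) (by nlinarith)
  refine ⟨a * v + (1 - a), h.down _ v (by nlinarith) (by nlinarith) hvD, by nlinarith, ?_⟩
  have h3 : f (a * u + (1 - a)) ≤ (1 - p) * f (a * u + (1 - a)) := by nlinarith
  have : p * f (a * v + (1 - a)) < p * ε := by linarith
  have := lt_of_mul_lt_mul_left this hp0.le
  linarith

lemma neg [IsProbabilityMeasure P] (h : OCore P f D) (y : ℝ) (hy0 : 0 ≤ y) (hy1 : y < 1) :
    f y < 0 := by
  by_contra hc
  obtain ⟨p, u, v, hp0, hp1, hu0, hu1, hvD, hv1, hk⟩ := h.shrink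
  have ha0 : 0 < (1 - y) / 2 := by linarith
  have ha1 : (1 - y) / 2 < 1 := by linarith
  have := hk _ ha0 ha1
  set a := (1 - y) / 2 with ha
  have h1 : f y ≤ f (a * u + (1 - a)) :=
    h.mono _ _ hy0 (by nlinarith) (h.down _ 1 (by nlinarith) (by nlinarith) h.one_mem)
  have h2 : 0 < f (a * v + (1 - a)) :=
    h.pos _ (h.down _ v (by nlinarith) (by nlinarith) hvD) (by nlinarith)
  have h3 : 0 ≤ (1 - p) * f (a * u + (1 - a)) := mul_nonneg (by linarith) (by linarith)
  have h4 : 0 < p * f (a * v + (1 - a)) := by positivity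
  linarith

/-- no jumps simultaneously on both sides of `1` -/
lemma two_jumps [IsProbabilityMeasure P] (h : OCore P f D) (c d z : ℝ) (hc : 1 < c) (hcd : c < d)
    (hd : d ∈ D) (hz0 : 0 ≤ z) (hz1 : z < 1) (hrc : ¬ RC f D c) : RC f D z := by
  by_contra hrz
  unfold RC at hrc hrz
  push Not at hrc hrz
  obtain ⟨e1, he1, hc'⟩ := hrc
  obtain ⟨e2, he2, hz'⟩ := hrz
  set S : Set ℝ := f '' {y | y ∈ D ∧ c < y} with hS
  set T : Set ℝ := f '' {y | y ∈ D ∧ z < y} with hT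
  have hSne : S.Nonempty := ⟨f d, d, ⟨hd, hcd⟩, rfl⟩
  have hTne : T.Nonempty := ⟨f d, d, ⟨hd, by linarith⟩, rfl⟩
  have hSl : f c + e1 ∈ lowerBounds S := by
    rintro _ ⟨y, ⟨hy, hy1⟩, rfl⟩; exact hc' y hy hy1
  have hTl : f z + e2 ∈ lowerBounds T := by
    rintro _ ⟨y, ⟨hy, hy1⟩, rfl⟩; exact hz' y hy hy1
  have hcD : c ∈ D := h.down c d (by linarith) hcd.le hd
  have hzD : z ∈ D := h.down z d (by linarith) (by linarith) hd
  have hS1 : f c + e1 ≤ sInf S := le_csInf hSne hSl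
  have hT1 : f z + e2 ≤ sInf T := le_csInf hTne hTl
  have hSle : ∀ y ∈ D, c < y → sInf S ≤ f y := fun y hy hy1 => csInf_le ⟨_, hSl⟩ ⟨y, ⟨hy, hy1⟩, rfl⟩
  have hTle : ∀ y ∈ D, z < y → sInf T ≤ f y := fun y hy hy1 => csInf_le ⟨_, hTl⟩ ⟨y, ⟨hy, hy1⟩, rfl⟩
  have hfc := h.pos c hcD hc
  set b := sInf S with hb
  set t := sInf T with ht
  have htneg : t < 0 := by
    have h1 := hTle ((z + 1) / 2) (h.down _ 1 (by linarith) (by linarith) h.one_mem) (by linarith)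
    have h2 := h.neg ((z + 1) / 2) (by linarith) (by linarith)
    linarith
  have hbt : 0 < b - t := by linarith
  set p0 := -t / (b - t) with hp0
  have hp0e : p0 * (b - t) = -t := by rw [hp0]; field_simp
  have hp0pos : 0 < p0 := div_pos (by linarith) hbt
  have hp0lt : p0 < 1 := by rw [hp0, div_lt_one hbt]; linarith
  have ev1 : ∀ᶠ p in nhds p0, p * b + (1 - p) * f z < 0 := by
    have hcont : Continuous fun p : ℝ => p * b + (1 - p) * f z := by fun_prop
    refine hcont.continuousAt.eventually (gt_mem_nhds ?_) |>.mono fun _ hx => hx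
    nlinarith
  have ev2 : ∀ᶠ p in nhds p0, p * f c + (1 - p) * t < 0 := by
    have hcont : Continuous fun p : ℝ => p * f c + (1 - p) * t := by fun_prop
    refine hcont.continuousAt.eventually (gt_mem_nhds ?_) |>.mono fun _ hx => hx
    nlinarith
  have ev3 : ∀ᶠ p in nhds p0, p < 1 := gt_mem_nhds hp0lt
  have ev4 : ∀ᶠ p in nhdsWithin p0 (Ioi p0), p0 < p := eventually_mem_nhdsWithin
  obtain ⟨p, ⟨⟨h1, h2⟩, h3⟩, h4⟩ :=
    ((((ev1.and ev2).and ev3).filter_mono nhdsWithin_le_nhds).and ev4).exists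
  have hp : 0 < p := by linarith
  have hp1 : 0 < 1 - p := by linarith
  -- strict points
  obtain ⟨_, ⟨y, ⟨hyD, hyc⟩, rfl⟩, hy⟩ := exists_lt_of_csInf_lt hSne
    (show sInf S < b + -(p * b + (1 - p) * f z) / p by
      have : 0 < -(p * b + (1 - p) * f z) / p := div_pos (by linarith) hp
      linarith)
  obtain ⟨_, ⟨w, ⟨hwD, hwz⟩, rfl⟩, hw⟩ := exists_lt_of_csInf_lt hTne
    (show sInf T < t + -(p * f c + (1 - p) * t) / (1 - p) by
      have : 0 < -(p * f c + (1 - p) * t) / (1 - p) := div_pos (by linarith) hp1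
      linarith)
  have k1 : p * f y + (1 - p) * f z ≤ 0 := by
    have : p * f y ≤ p * (b + -(p * b + (1 - p) * f z) / p) := mul_le_mul_of_nonneg_left hy.le hp.le
    have e : p * (b + -(p * b + (1 - p) * f z) / p) = - ((1 - p) * f z) := by field_simp; ring
    linarith
  have k2 : p * f c + (1 - p) * f w ≤ 0 := by
    have : (1 - p) * f w ≤ (1 - p) * (t + -(p * f c + (1 - p) * t) / (1 - p)) :=
      mul_le_mul_of_nonneg_left hw.le hp1.le
    have e : (1 - p) * (t + -(p * f c + (1 - p) * t) / (1 - p)) = - (p * f c) := by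
      field_simp; ring
    linarith
  have k3 := h.acc2 p hp.le h3.le (1/2) (by norm_num) (by norm_num) y z c w hyD hzD hcD hwD k1 k2
  have m1 := hSle (1/2 * y + (1 - 1/2) * c) (h.down _ y (by linarith) (by linarith) hyD) (by linarith)
  have m2 := hTle (1/2 * z + (1 - 1/2) * w) (h.down _ w (by linarith) (by linarith) hwD) (by linarith)
  nlinarith

/-- Convexity of a two dimensional level set. -/
lemma level (h : OCore P f D) (A B : Set Ω) (hA : MeasurableSet A) (hB : MeasurableSet B)
    (hd : Disjoint A B) (hlt : P.real A + P.real B < 1) (K z : ℝ) (hz : z ∈ D)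
    (hzK : f z = - (K / (1 - P.real A - P.real B))) (x₁ x₂ y₁ y₂ : ℝ)
    (hx₁ : x₁ ∈ D) (hx₂ : x₂ ∈ D) (hy₁ : y₁ ∈ D) (hy₂ : y₂ ∈ D)
    (hx : P.real A * f x₁ + P.real B * f x₂ ≤ K) (hy : P.real A * f y₁ + P.real B * f y₂ ≤ K) :
    P.real A * f ((x₁ + y₁) / 2) + P.real B * f ((x₂ + y₂) / 2) ≤ K := by
  have hne : 1 - P.real A - P.real B ≠ 0 := by linarith
  have e : (1 - P.real A - P.real B) * f z = - K := by rw [hzK]; field_simp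
  have := h.acc A B hA hB hd (1/2) (by norm_num) (by norm_num) x₁ hx₁ x₂ hx₂ z hz y₁ hy₁ y₂ hy₂ z hz
    (by linarith) (by linarith)
  have e1 : (1/2 : ℝ) * x₁ + (1 - 1/2) * y₁ = (x₁ + y₁) / 2 := by ring
  have e2 : (1/2 : ℝ) * x₂ + (1 - 1/2) * y₂ = (x₂ + y₂) / 2 := by ring
  have e3 : (1/2 : ℝ) * z + (1 - 1/2) * z = z := by ring
  rw [e1, e2, e3] at this
  linarith

set_option maxHeartbeats 1000000 in
/-- Jumps are impossible when all small values of the opposite sign are attained. -/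
lemma jump_kill [IsProbabilityMeasure P] (h : OCore P f D) (c d σ v : ℝ) (hσ : σ = 1 ∨ σ = -1)
    (hc : 0 ≤ c) (hcd : c < d)
    (hd : d ∈ D) (hsg : ∀ y, c ≤ y → y ≤ d → 0 ≤ σ * f y) (hv : 0 < v)
    (hI : ∀ τ, 0 ≤ σ * τ → |τ| ≤ v → ∃ z ∈ D, f z = -τ) : RC f D c := by
  by_contra hrc
  unfold RC at hrc
  push Not at hrc
  obtain ⟨e1, he1, hc'⟩ := hrc
  set S : Set ℝ := f '' {y | y ∈ D ∧ c < y} with hS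
  have hSne : S.Nonempty := ⟨f d, d, ⟨hd, hcd⟩, rfl⟩
  have hSl : f c + e1 ∈ lowerBounds S := by
    rintro _ ⟨y, ⟨hy, hy1⟩, rfl⟩; exact hc' y hy hy1
  have hcD : c ∈ D := h.down c d hc hcd.le hd
  have hS1 : f c + e1 ≤ sInf S := le_csInf hSne hSl
  have hSle : ∀ y ∈ D, c < y → sInf S ≤ f y := fun y hy hy1 => csInf_le ⟨_, hSl⟩ ⟨y, ⟨hy, hy1⟩, rfl⟩
  set b := sInf S with hb
  set M := |f c| + |f d| + 1 with hM
  have hMpos : 0 < M := by positivity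
  obtain ⟨A, B, hA, hB, hdis, hA0, hB0, hAB⟩ := small_sets P h.mass (min (1/2) (v / (2 * M)))
    (lt_min (by norm_num) (by positivity))
  set p := P.real A with hp
  set r := P.real B with hr
  have hAB1 : p + r ≤ 1/2 := hAB.trans (min_le_left _ _)
  have hAB2 : p + r ≤ v / (2 * M) := hAB.trans (min_le_right _ _)
  rw [le_div_iff₀ (by positivity)] at hAB2
  -- slack
  set δ := min p r * (b - f c) with hδ
  have hδ0 : 0 < δ := mul_pos (lt_min hA0 hB0) (by linarith)
  obtain ⟨_, ⟨y, ⟨hyD, hyc⟩, rfl⟩, hy⟩ := exists_lt_of_csInf_lt hSne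
    (show sInf S < b + δ by linarith)
  -- use a point close to c and at most d
  set w := min y d with hw
  have hwc : c < w := lt_min hyc hcd
  have hwD : w ∈ D := h.down w d (by linarith) (min_le_right _ _) hd
  have hfw : f w ≤ f y := h.mono w y (by linarith) (min_le_left _ _) hyD
  have hfwd : f w ≤ f d := h.mono w d (by linarith) (min_le_right _ _) hd
  have hfcw : f c ≤ f w := h.mono c w hc hwc.le hwD
  set K := max (p * f w + r * f c) (p * f c + r * f w) with hK
  have habs : ∀ x, f c ≤ x → x ≤ f d → |x| ≤ M := by
    intro x h1 h2
    rw [abs_le]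
    constructor <;> [linarith [neg_abs_le (f c), abs_nonneg (f d)]; linarith [le_abs_self (f d), abs_nonneg (f c)]]
  have hKabs : |K| ≤ (p + r) * M := by
    have a1 := abs_le.mp (habs (f w) hfcw hfwd)
    have a2 := abs_le.mp (habs (f c) le_rfl (hfcw.trans hfwd))
    have b1 := mbound p M (f w) hA0 a1
    have b2 := mbound r M (f w) hB0 a1
    have b3 := mbound p M (f c) hA0 a2
    have b4 := mbound r M (f c) hB0 a2
    rw [abs_le]
    constructor
    · exact le_max_of_le_left (by linarith)
    · exact max_le (by linarith) (by linarith)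
  have hKs : 0 ≤ σ * K := by
    have s1 := hsg w hwc.le (min_le_right _ _)
    have s2 := hsg c le_rfl hcd.le
    have t1 : 0 ≤ σ * (p * f w + r * f c) := by nlinarith
    have t2 : 0 ≤ σ * (p * f c + r * f w) := by nlinarith
    rcases max_choice (p * f w + r * f c) (p * f c + r * f w) with hh | hh <;> rw [hK, hh] <;> assumption
  have hden : 0 < 1 - p - r := by linarith
  obtain ⟨z, hz, hzK⟩ := hI (K / (1 - p - r))
    (by rw [← mul_div_assoc]; exact div_nonneg hKs hden.le)
    (by rw [abs_div, abs_of_pos hden, div_le_iff₀ hden]; nlinarith)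
  have hlev := h.level A B hA hB hdis (by linarith) K z hz hzK w c c w hwD hcD hcD hwD
    (le_max_left _ _) (le_max_right _ _)
  have m1 : b ≤ f ((w + c) / 2) := hSle _ (h.down _ w (by linarith) (by linarith) hwD) (by linarith)
  have m2 : b ≤ f ((c + w) / 2) := hSle _ (h.down _ w (by linarith) (by linarith) hwD) (by linarith)
  have q1 : min p r ≤ p := min_le_left _ _
  have q2 : min p r ≤ r := min_le_right _ _
  have hlow : (p + r) * b ≤ K := by nlinarith
  have hup : K < (p + r) * b := by
    have g1 : f w < b + δ := by linarith
    have n1 : p * f w + r * f c < (p + r) * b := by nlinarith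
    have n2 : p * f c + r * f w < (p + r) * b := by nlinarith
    exact max_lt n1 n2
  linarith

lemma contOn (h : OCore P f D) (s t : ℝ) (hs : 0 ≤ s) (ht : t ∈ D)
    (hrc : ∀ c, s ≤ c → c < t → RC f D c) : ContinuousOn f (Icc s t) := by
  intro x hx
  rw [Metric.continuousWithinAt_iff]
  intro ε hε
  have hxD : x ∈ D := h.down x t (hs.trans hx.1) hx.2 ht
  have hl : ∃ l < x, ∀ y ∈ Icc s t, l < y → f x - ε < f y := by
    by_cases hx0 : 0 < x
    · obtain ⟨y, hy0, hyx, hy⟩ := h.lc x hxD hx0 ε hε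
      refine ⟨y, hyx, fun w hw hyw => hy.trans_le ?_⟩
      exact h.mono y w hy0 hyw.le (h.down w t (hs.trans hw.1) hw.2 ht)
    · refine ⟨x - 1, by linarith, fun w hw _ => ?_⟩
      have := h.mono x w (hs.trans hx.1) (by linarith [hw.1]) (h.down w t (hs.trans hw.1) hw.2 ht)
      linarith
  have hr : ∃ r > x, ∀ y ∈ Icc s t, y < r → f y < f x + ε := by
    by_cases hxt : x < t
    · obtain ⟨y, hyD, hyx, hy⟩ := hrc x hx.1 hxt ε hε
      exact ⟨y, hyx, fun w hw hyw => (h.mono w y (hs.trans hw.1) hyw.le hyD).trans_lt hy⟩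
    · refine ⟨x + 1, by linarith, fun w hw _ => ?_⟩
      have := h.mono w x (hs.trans hw.1) (by linarith [hw.2]) hxD
      linarith
  obtain ⟨l, hl, hl'⟩ := hl
  obtain ⟨r, hr, hr'⟩ := hr
  refine ⟨min (x - l) (r - x), lt_min (by linarith) (by linarith), fun y hy hyd => ?_⟩
  rw [Real.dist_eq, lt_min_iff, abs_lt, abs_lt] at hyd
  have h1 := hl' y hy (by linarith [hyd.1.1])
  have h2 := hr' y hy (by linarith [hyd.2.2])
  rw [Real.dist_eq, abs_lt]
  constructor <;> linarith

lemma neg_ivt [IsProbabilityMeasure P] (h : OCore P f D) (hrc : ∀ c, 0 ≤ c → c < 1 → RC f D c) :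
    ∃ v > 0, ∀ τ, -v ≤ τ → τ ≤ 0 → ∃ z ∈ D, f z = τ := by
  refine ⟨- f 0, by linarith [h.neg 0 le_rfl one_pos], fun τ h1 h2 => ?_⟩
  have hc := h.contOn 0 1 le_rfl h.one_mem hrc
  obtain ⟨z, hz, hzτ⟩ := intermediate_value_Icc zero_le_one hc
    (show τ ∈ Icc (f 0) (f 1) from ⟨by linarith, by rw [h.f_one]; exact h2⟩)
  exact ⟨z, h.down z 1 hz.1 hz.2 h.one_mem, hzτ⟩

lemma pos_ivt [IsProbabilityMeasure P] (h : OCore P f D)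
    (hrc : ∀ c d, 1 < c → c < d → d ∈ D → RC f D c) :
    ∃ v > 0, ∀ τ, 0 ≤ τ → τ ≤ v → ∃ z ∈ D, f z = τ := by
  obtain ⟨u, huD, hu1⟩ := h.exu2
  refine ⟨f u, h.pos u huD hu1, fun τ h1 h2 => ?_⟩
  have hc := h.contOn 1 u zero_le_one huD (by
    intro c hc hcu
    rcases hc.eq_or_lt with rfl | hc
    · exact h.rc_one
    · exact hrc c u hc hcu huD)
  obtain ⟨z, hz, hzτ⟩ := intermediate_value_Icc hu1.le hc
    (show τ ∈ Icc (f 1) (f u) from ⟨by rw [h.f_one]; exact h1, h2⟩)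
  exact ⟨z, h.down z u (zero_le_one.trans hz.1) hz.2 huD, hzτ⟩

lemma rc_right [IsProbabilityMeasure P] (h : OCore P f D) (hrc : ∀ c, 0 ≤ c → c < 1 → RC f D c)
    (c d : ℝ) (hc : 1 < c) (hcd : c < d) (hd : d ∈ D) : RC f D c := by
  obtain ⟨v, hv, hI⟩ := h.neg_ivt hrc
  refine h.jump_kill c d 1 v (Or.inl rfl) (by linarith) hcd hd (fun y h1 h2 => ?_) hv
    fun τ h1 h2 => hI (-τ) ?_ ?_
  · have := h.pos y (h.down y d (by linarith) h2 hd) (by linarith)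
    linarith
  · linarith [(abs_le.mp h2).2]
  · linarith

lemma rc_left [IsProbabilityMeasure P] (h : OCore P f D) (c : ℝ) (hc0 : 0 ≤ c) (hc : c < 1) :
    RC f D c := by
  by_contra hn
  have hr : ∀ c d, 1 < c → c < d → d ∈ D → RC f D c := by
    intro c' d hc' hcd hd
    by_contra hn'
    exact hn (h.two_jumps c' d c hc' hcd hd hc0 hc hn')
  obtain ⟨v, hv, hI⟩ := h.pos_ivt hr
  refine hn (h.jump_kill c 1 (-1) v (Or.inr rfl) hc0 hc h.one_mem (fun y h1 h2 => ?_) hv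
    fun τ h1 h2 => hI (-τ) ?_ ?_)
  · have := h.np y (by linarith) h2
    linarith
  · linarith
  · linarith [(abs_le.mp h2).1]

lemma rc_all [IsProbabilityMeasure P] (h : OCore P f D) (c d : ℝ) (hc : 0 ≤ c) (hcd : c < d)
    (hd : d ∈ D) : RC f D c := by
  rcases lt_trichotomy c 1 with h1 | rfl | h1
  · exact h.rc_left c hc h1
  · exact h.rc_one
  · exact h.rc_right h.rc_left c d h1 hcd hd

lemma ivt [IsProbabilityMeasure P] (h : OCore P f D) :
    ∃ v > 0, ∀ τ, |τ| ≤ v → ∃ z ∈ D, f z = τ := by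
  obtain ⟨v, hv, hI⟩ := h.neg_ivt h.rc_left
  obtain ⟨w, hw, hJ⟩ := h.pos_ivt (h.rc_right h.rc_left)
  refine ⟨min v w, lt_min hv hw, fun τ hτ => ?_⟩
  rw [abs_le] at hτ
  have h1 := min_le_left v w
  have h2 := min_le_right v w
  rcases le_total τ 0 with h0 | h0
  · exact hI τ (by linarith) h0
  · exact hJ τ h0 (by linarith)

set_option maxHeartbeats 1000000 in
lemma convex [IsProbabilityMeasure P] (h : OCore P f D) (s t a : ℝ) (hs : 0 ≤ s) (ht : t ∈ D)
    (hst : s < t) (ha0 : 0 < a) (ha1 : a < 1) :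
    f (a * s + (1 - a) * t) ≤ a * f s + (1 - a) * f t := by
  by_contra hcon
  push Not at hcon
  have hcont : ContinuousOn f (Icc s t) :=
    h.contOn s t hs ht fun c hc hct => h.rc_all c t (hs.trans hc) hct ht
  set m := a * s + (1 - a) * t with hm
  have hms : s < m := by nlinarith
  have hmt : m < t := by nlinarith
  set k := (f t - f s) / (t - s) with hk
  have hts : 0 < t - s := by linarith
  have hkt : k * (t - s) = f t - f s := by rw [hk]; field_simp
  set G := f m - (a * f s + (1 - a) * f t) with hG
  have hG0 : 0 < G := by linarith
  set η := G / (2 * (t - s) ^ 2) with hη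
  have hη0 : 0 < η := by positivity
  have hηe : η * (t - s) ^ 2 = G / 2 := by rw [hη]; field_simp
  set g : ℝ → ℝ := fun x => f x - k * x + η * (x - m) ^ 2 with hg
  have hgc : ContinuousOn g (Icc s t) := by
    apply ContinuousOn.add
    · exact hcont.sub (by fun_prop)
    · fun_prop
  obtain ⟨x, hx, hmax⟩ := isCompact_Icc.exists_isMaxOn (nonempty_Icc.mpr hst.le) hgc
  have hmax' : ∀ y, s ≤ y → y ≤ t → g y ≤ g x := fun y h1 h2 => hmax ⟨h1, h2⟩
  have hgm : g m = G + (f s - k * s) := by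
    simp only [hg, hG, hm]
    linear_combination (1 - a) * (-hkt)
  have hbd : ∀ y, s ≤ y → y ≤ t → η * (y - m) ^ 2 ≤ G / 2 := by
    intro y h1 h2
    rw [← hηe]
    apply mul_le_mul_of_nonneg_left _ hη0.le
    apply sq_le_sq'
    · linarith
    · linarith
  have hxs : x ≠ s := by
    rintro rfl
    have h1 := hmax' m hms.le hmt.le
    have h2 := hbd x le_rfl hst.le
    rw [hgm] at h1
    simp only [hg] at h1
    linarith
  have hxt : x ≠ t := by
    rintro rfl
    have h1 := hmax' m hms.le hmt.le
    have h2 := hbd x hst.le le_rfl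
    rw [hgm] at h1
    simp only [hg] at h1
    nlinarith
  have hxs' : s < x := lt_of_le_of_ne hx.1 (Ne.symm hxs)
  have hxt' : x < t := lt_of_le_of_ne hx.2 hxt
  -- choose small sets
  obtain ⟨v, hv, hI⟩ := h.ivt
  set M := |f s| + |f t| + 1 with hM
  have hMpos : 0 < M := by positivity
  obtain ⟨A, B, hA, hB, hdis, hA0, hB0, hAB⟩ := small_sets P h.mass (min (1/2) (v / (2 * M)))
    (lt_min (by norm_num) (by positivity))
  set p := P.real A with hp
  set r := P.real B with hr
  have hAB1 : p + r ≤ 1/2 := hAB.trans (min_le_left _ _)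
  have hAB2 : p + r ≤ v / (2 * M) := hAB.trans (min_le_right _ _)
  rw [le_div_iff₀ (by positivity)] at hAB2
  set ρ := min (x - s) (t - x) with hρ
  have hρ0 : 0 < ρ := lt_min (by linarith) (by linarith)
  have hρ1 : ρ ≤ x - s := min_le_left _ _
  have hρ2 : ρ ≤ t - x := min_le_right _ _
  have rle : r * ρ ≤ ρ := by nlinarith
  have ple : p * ρ ≤ ρ := by nlinarith
  have rpos : 0 < r * ρ := by positivity
  have ppos : 0 < p * ρ := by positivity
  have hin : ∀ y, s ≤ y → y ≤ t → y ∈ D := fun y h1 h2 => h.down y t (hs.trans h1) h2 ht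
  have hMb : ∀ y, s ≤ y → y ≤ t → -M ≤ f y ∧ f y ≤ M := by
    intro y h1 h2
    have a1 := h.mono s y hs h1 (hin y h1 h2)
    have a2 := h.mono y t (hs.trans h1) h2 ht
    constructor
    · linarith [neg_abs_le (f s), abs_nonneg (f t)]
    · linarith [le_abs_self (f t), abs_nonneg (f s)]
  set K := max (p * f (x + r * ρ) + r * f (x - p * ρ)) (p * f (x - r * ρ) + r * f (x + p * ρ)) with hK
  have c1 := hMb (x + r * ρ) (by linarith) (by linarith)
  have c2 := hMb (x - p * ρ) (by linarith) (by linarith)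
  have c3 := hMb (x - r * ρ) (by linarith) (by linarith)
  have c4 := hMb (x + p * ρ) (by linarith) (by linarith)
  have hKabs : |K| ≤ (p + r) * M := by
    have d1 := mbound p M _ hA0 c1
    have d2 := mbound r M _ hB0 c2
    have d3 := mbound p M _ hA0 c3
    have d4 := mbound r M _ hB0 c4
    rw [abs_le]
    constructor
    · exact le_max_of_le_left (by linarith)
    · exact max_le (by linarith) (by linarith)
  have hden : 0 < 1 - p - r := by linarith
  obtain ⟨z, hz, hzK⟩ := hI (-(K / (1 - p - r)))
    (by rw [abs_neg, abs_div, abs_of_pos hden, div_le_iff₀ hden]; nlinarith)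
  have hlev := h.level A B hA hB hdis (by linarith) K z hz hzK (x + r * ρ) (x - p * ρ) (x - r * ρ)
    (x + p * ρ) (hin _ (by linarith) (by linarith)) (hin _ (by linarith) (by linarith))
    (hin _ (by linarith) (by linarith)) (hin _ (by linarith) (by linarith))
    (le_max_left _ _) (le_max_right _ _)
  have e1 : (x + r * ρ + (x - r * ρ)) / 2 = x := by ring
  have e2 : (x - p * ρ + (x + p * ρ)) / 2 = x := by ring
  rw [e1, e2] at hlev
  have g1 := hmax' (x + r * ρ) (by linarith) (by linarith)
  have g2 := hmax' (x - p * ρ) (by linarith) (by linarith)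
  have g3 := hmax' (x - r * ρ) (by linarith) (by linarith)
  have g4 := hmax' (x + p * ρ) (by linarith) (by linarith)
  simp only [hg] at g1 g2 g3 g4
  have q1 := mul_le_mul_of_nonneg_left g1 hA0.le
  have q2 := mul_le_mul_of_nonneg_left g2 hB0.le
  have q3 := mul_le_mul_of_nonneg_left g3 hA0.le
  have q4 := mul_le_mul_of_nonneg_left g4 hB0.le
  have hδ : 0 < η * (p * (r * ρ) ^ 2 + r * (p * ρ) ^ 2) := by positivity
  have hup : K < p * f x + r * f x := by
    apply max_lt
    · linarith only [q1, q2, hδ]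
    · linarith only [q3, q4, hδ]
  linarith

end OCore

open Classical in
/-- three-valued function -/
def tri {β : Type*} (A B : Set Ω) (x₁ x₂ x₃ : β) : Ω → β :=
  fun ω => if ω ∈ A then x₁ else if ω ∈ B then x₂ else x₃

lemma tri_comp {β γ : Type*} (A B : Set Ω) (x₁ x₂ x₃ : β) (g : β → γ) :
    (fun ω => g (tri A B x₁ x₂ x₃ ω)) = tri A B (g x₁) (g x₂) (g x₃) := by
  funext ω
  unfold tri
  split_ifs <;> rfl

lemma measurable_tri (A B : Set Ω) (hA : MeasurableSet A) (hB : MeasurableSet B) (x₁ x₂ x₃ : ℝ) :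
    Measurable (tri A B x₁ x₂ x₃) :=
  Measurable.ite hA measurable_const (Measurable.ite hB measurable_const measurable_const)

lemma real_compl_union (P : Measure Ω) [IsProbabilityMeasure P] (A B : Set Ω) (hA : MeasurableSet A)
    (hB : MeasurableSet B) (hd : Disjoint A B) :
    P.real (A ∪ B)ᶜ = 1 - P.real A - P.real B := by
  rw [probReal_compl_eq_one_sub (hA.union hB), measureReal_union hd hB]; ring

lemma lintegral_tri (P : Measure Ω) [IsProbabilityMeasure P] (A B : Set Ω) (hA : MeasurableSet A)
    (hB : MeasurableSet B) (hd : Disjoint A B) (v₁ v₂ v₃ : ℝ) :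
    ∫⁻ ω, ENNReal.ofReal (tri A B v₁ v₂ v₃ ω) ∂P =
      ENNReal.ofReal (P.real A * max v₁ 0 + P.real B * max v₂ 0
        + (1 - P.real A - P.real B) * max v₃ 0) := by
  have h1 : (fun ω => ENNReal.ofReal (tri A B v₁ v₂ v₃ ω)) = fun ω =>
      A.indicator (fun _ => ENNReal.ofReal v₁) ω + (B.indicator (fun _ => ENNReal.ofReal v₂) ω
        + (A ∪ B)ᶜ.indicator (fun _ => ENNReal.ofReal v₃) ω) := by
    funext ω
    unfold tri
    by_cases h1 : ω ∈ A
    · have h2 : ω ∉ B := fun h2 => Set.disjoint_left.mp hd h1 h2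
      simp [h1, h2]
    · by_cases h2 : ω ∈ B <;> simp [h1, h2]
  have conv : ∀ (S : Set Ω) (v : ℝ), ENNReal.ofReal v * P S = ENNReal.ofReal (P.real S * max v 0) := by
    intro S v
    rw [ENNReal.ofReal_mul measureReal_nonneg, ofReal_measureReal, mul_comm]
    congr 1
    rcases le_total v 0 with h | h
    · rw [max_eq_right h, ENNReal.ofReal_of_nonpos h, ENNReal.ofReal_zero]
    · rw [max_eq_left h]
  rw [h1, lintegral_add_left (measurable_const.indicator hA),
    lintegral_add_left (measurable_const.indicator hB), lintegral_indicator_const hA,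
    lintegral_indicator_const hB, lintegral_indicator_const (hA.union hB).compl,
    conv, conv, conv, ← ENNReal.ofReal_add, ← ENNReal.ofReal_add, real_compl_union P A B hA hB hd,
    add_assoc]
  all_goals
    have := fun S : Set Ω => measureReal_nonneg (μ := P) (s := S)
    have h4 := this A
    have h5 := this B
    have h6 := this (A ∪ B)ᶜ
    positivity

lemma erealToENNReal_coe (v : ℝ) : erealToENNReal (v : EReal) = ENNReal.ofReal v := by
  simp [erealToENNReal]

lemma eexp_tri (P : Measure Ω) [IsProbabilityMeasure P] (A B : Set Ω) (hA : MeasurableSet A)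
    (hB : MeasurableSet B) (hd : Disjoint A B) (v₁ v₂ v₃ : ℝ) :
    eexp P (tri A B (v₁ : EReal) (v₂ : EReal) (v₃ : EReal)) =
      ((P.real A * v₁ + P.real B * v₂ + (1 - P.real A - P.real B) * v₃ : ℝ) : EReal) := by
  have hC : 0 ≤ 1 - P.real A - P.real B := by
    rw [← real_compl_union P A B hA hB hd]; exact measureReal_nonneg
  have hPA : 0 ≤ P.real A := measureReal_nonneg
  have hPB : 0 ≤ P.real B := measureReal_nonneg
  have e1 : (fun ω => erealToENNReal (tri A B (v₁ : EReal) (v₂ : EReal) (v₃ : EReal) ω)) =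
      fun ω => ENNReal.ofReal (tri A B v₁ v₂ v₃ ω) := by
    rw [tri_comp, tri_comp]
    simp only [erealToENNReal_coe]
  have e2 : (fun ω => erealToENNReal (-(tri A B (v₁ : EReal) (v₂ : EReal) (v₃ : EReal) ω))) =
      fun ω => ENNReal.ofReal (tri A B (-v₁) (-v₂) (-v₃) ω) := by
    rw [tri_comp A B _ _ _ (fun x => erealToENNReal (-x)), tri_comp]
    simp only [← EReal.coe_neg, erealToENNReal_coe]
  have n : ∀ a b c : ℝ, 0 ≤ P.real A * max a 0 + P.real B * max b 0
      + (1 - P.real A - P.real B) * max c 0 := fun a b c =>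
    add_nonneg (add_nonneg (mul_nonneg hPA (le_max_right _ _)) (mul_nonneg hPB (le_max_right _ _)))
      (mul_nonneg hC (le_max_right _ _))
  unfold eexp
  rw [e1, e2, lintegral_tri P A B hA hB hd, lintegral_tri P A B hA hB hd, EReal.coe_ennreal_ofReal,
    EReal.coe_ennreal_ofReal, max_eq_left (n v₁ v₂ v₃), max_eq_left (n (-v₁) (-v₂) (-v₃)),
    ← EReal.coe_sub]
  congr 1
  have key : ∀ v : ℝ, v = max v 0 - max (-v) 0 := by
    intro v
    rcases le_total v 0 with h | h
    · rw [max_eq_right h, max_eq_left (by linarith)]; ring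
    · rw [max_eq_left h, max_eq_right (by linarith)]; ring
  conv_rhs => rw [key v₁, key v₂, key v₃]
  ring

lemma erealToENNReal_mono {x y : EReal} (h : x ≤ y) : erealToENNReal x ≤ erealToENNReal y :=
  EReal.toENNReal_le_toENNReal h

lemma eexp_mono (P : Measure Ω) (f g : Ω → EReal) (h : ∀ ω, f ω ≤ g ω) : eexp P f ≤ eexp P g := by
  unfold eexp
  apply EReal.sub_le_sub
  · exact_mod_cast lintegral_mono fun ω => erealToENNReal_mono (h ω)
  · exact_mod_cast lintegral_mono fun ω => erealToENNReal_mono (EReal.neg_le_neg_iff.mpr (h ω))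

lemma zero_ne_bot (P : Measure Ω) [IsProbabilityMeasure P] (hP : AllMass P)
    (Φ : ℝ → EReal) (hΦ : IsOrliczFunction Φ)
    (hconvH : ∀ X Y : Ω → ℝ, MemLinftyPlus P X → MemLinftyPlus P Y →
      ∀ a ∈ Set.Ioo (0 : ℝ) 1,
        orliczPremium P Φ (fun ω => a * X ω + (1 - a) * Y ω) ≤
          a * orliczPremium P Φ X + (1 - a) * orliczPremium P Φ Y) : Φ 0 ≠ ⊥ := by
  intro hbot
  obtain ⟨A, hA, hPA⟩ := hP (1/2) (by norm_num) (by norm_num)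
  have hPAc : P.real Aᶜ = 1/2 := by rw [probReal_compl_eq_one_sub hA, hPA]; norm_num
  have pos_of : ∀ S : Set Ω, P.real S = 1/2 → 0 < P S := by
    intro S hS
    rw [pos_iff_ne_zero]
    intro h0
    simp [Measure.real, h0] at hS
  have hmem : ∀ S : Set Ω, MeasurableSet S → MemLinftyPlus P (tri S ∅ (1:ℝ) 0 0) := by
    intro S hS
    refine ⟨measurable_tri S ∅ hS MeasurableSet.empty _ _ _, ae_of_all _ fun ω => ?_, 1,
      ae_of_all _ fun ω => ?_⟩ <;> unfold tri <;> split_ifs <;> norm_num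
  have hprem : ∀ S : Set Ω, P.real Sᶜ = 1/2 → orliczPremium P Φ (tri S ∅ (1:ℝ) 0 0) = 0 := by
    intro S hS
    unfold orliczPremium
    rw [if_pos]
    refine ⟨hbot, (pos_of _ hS).trans_le (measure_mono ?_)⟩
    intro ω hω
    have : ω ∉ S := hω
    simp [tri, this]
  have h1 := hconvH _ _ (hmem A hA) (hmem Aᶜ hA.compl) (1/2) ⟨by norm_num, by norm_num⟩
  rw [hprem A hPAc, hprem Aᶜ (by rw [compl_compl]; exact hPA)] at h1
  have e : (fun ω => (1/2 : ℝ) * tri A ∅ (1:ℝ) 0 0 ω + (1 - 1/2) * tri Aᶜ ∅ (1:ℝ) 0 0 ω) =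
      fun _ => (1/2 : ℝ) := by
    funext ω
    by_cases h : ω ∈ A <;> simp [tri, h]
    norm_num
  rw [e] at h1
  unfold orliczPremium at h1
  rw [if_neg (by simp)] at h1
  have h2 : (1/2 : ℝ) ≤ sInf {k : ℝ | 0 < k ∧ eexp P (fun _ => Φ ((1/2) / k)) ≤ 1} := by
    apply le_csInf
    · refine ⟨1, one_pos, ?_⟩
      have hne := hΦ.ne_bot (1/2/1) (by norm_num)
      have hle := hΦ.le_one (1/2/1) (by norm_num) (by norm_num)
      have hnt : Φ (1/2/1) ≠ ⊤ := fun ht => by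
        rw [ht] at hle; exact absurd (top_le_iff.mp hle) (EReal.coe_ne_top 1)
      rw [← EReal.coe_toReal hnt hne] at hle ⊢
      have := eexp_tri P ∅ ∅ MeasurableSet.empty MeasurableSet.empty (by simp) (Φ (1/2/1)).toReal
        (Φ (1/2/1)).toReal (Φ (1/2/1)).toReal
      simp only [measureReal_empty, zero_mul, zero_add, sub_zero, one_mul] at this
      have e3 : tri (∅ : Set Ω) ∅ ((Φ (1/2/1)).toReal : EReal) ((Φ (1/2/1)).toReal : EReal)
        ((Φ (1/2/1)).toReal : EReal) = fun _ => ((Φ (1/2/1)).toReal : EReal) := by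
        funext ω; simp [tri]
      rw [e3] at this
      rw [this]; exact hle
    · rintro k ⟨hk, hke⟩
      by_contra hlt
      push Not at hlt
      have hgt : 1 < Φ (1/2/k) := hΦ.one_lt _ (by rw [lt_div_iff₀ hk]; linarith)
      obtain ⟨v, hv1, hv2⟩ := EReal.lt_iff_exists_real_btwn.mp hgt
      have hm := eexp_mono P (fun _ => (v : EReal)) (fun _ => Φ (1/2/k)) fun _ => hv2.le
      have := eexp_tri P ∅ ∅ MeasurableSet.empty MeasurableSet.empty (by simp) v v v
      simp only [measureReal_empty, zero_mul, zero_add, sub_zero, one_mul] at this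
      have e3 : tri (∅ : Set Ω) ∅ (v : EReal) (v : EReal) (v : EReal) = fun _ => (v : EReal) := by
        funext ω; simp [tri]
      rw [e3] at this
      rw [this] at hm
      exact absurd (hv1.trans_le (hm.trans hke)) (lt_irrefl _)
  linarith

/-- The finite domain. -/
def fdom (Φ : ℝ → EReal) : Set ℝ := {x | 0 ≤ x ∧ Φ x < ⊤}

lemma fdom_down {Φ : ℝ → EReal} (hΦ : IsOrliczFunction Φ) (x y : ℝ) (hx : 0 ≤ x) (hxy : x ≤ y)
    (hy : y ∈ fdom Φ) : x ∈ fdom Φ := ⟨hx, (hΦ.mono x y hx hxy).trans_lt hy.2⟩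

lemma fdom_coe {Φ : ℝ → EReal} (hΦ : IsOrliczFunction Φ) (h0 : Φ 0 ≠ ⊥) (x : ℝ)
    (hx : x ∈ fdom Φ) : Φ x = ((Φ x).toReal : EReal) := by
  refine (EReal.coe_toReal hx.2.ne ?_).symm
  rcases hx.1.eq_or_lt with h | h
  · rw [← h]; exact h0
  · exact hΦ.ne_bot x h

lemma fdom_lc {Φ : ℝ → EReal} (hΦ : IsOrliczFunction Φ) (h0 : Φ 0 ≠ ⊥) (x : ℝ)
    (hx : x ∈ fdom Φ) (hx0 : 0 < x) (ε : ℝ) (hε : 0 < ε) :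
    ∃ y, 0 ≤ y ∧ y < x ∧ (Φ x).toReal - ε < (Φ y).toReal := by
  have h1 : (((Φ x).toReal - ε : ℝ) : EReal) < ⨆ y : Set.Ico (0 : ℝ) x, Φ (y : ℝ) := by
    rw [← hΦ.left_cont x hx0]
    conv_rhs => rw [fdom_coe hΦ h0 x hx]
    exact_mod_cast sub_lt_self _ hε
  obtain ⟨⟨y, hy0, hyx⟩, hy⟩ := lt_iSup_iff.mp h1
  refine ⟨y, hy0, hyx, ?_⟩
  simp only at hy
  rw [fdom_coe hΦ h0 y (fdom_down hΦ y x hy0 hyx.le hx)] at hy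
  exact_mod_cast hy

lemma fdom_mono {Φ : ℝ → EReal} (hΦ : IsOrliczFunction Φ) (h0 : Φ 0 ≠ ⊥) (x y : ℝ) (hx : 0 ≤ x)
    (hxy : x ≤ y) (hy : y ∈ fdom Φ) : (Φ x).toReal ≤ (Φ y).toReal := by
  have := hΦ.mono x y hx hxy
  rw [fdom_coe hΦ h0 x (fdom_down hΦ x y hx hxy hy), fdom_coe hΦ h0 y hy] at this
  exact_mod_cast this

lemma fdom_le_one {Φ : ℝ → EReal} (hΦ : IsOrliczFunction Φ) (h0 : Φ 0 ≠ ⊥) (x : ℝ) (hx : 0 ≤ x)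
    (hx1 : x ≤ 1) : x ∈ fdom Φ ∧ (Φ x).toReal ≤ 1 := by
  have h := hΦ.le_one x hx hx1
  have hD : x ∈ fdom Φ := ⟨hx, h.trans_lt (by exact_mod_cast EReal.coe_lt_top 1)⟩
  refine ⟨hD, ?_⟩
  rw [fdom_coe hΦ h0 x hD] at h
  exact_mod_cast h

lemma eexp_phi (P : Measure Ω) [IsProbabilityMeasure P] {Φ : ℝ → EReal} (hΦ : IsOrliczFunction Φ)
    (h0 : Φ 0 ≠ ⊥) (A B : Set Ω) (hA : MeasurableSet A)
    (hB : MeasurableSet B) (hd : Disjoint A B) (x₁ x₂ x₃ k : ℝ)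
    (h₁ : x₁ / k ∈ fdom Φ) (h₂ : x₂ / k ∈ fdom Φ) (h₃ : x₃ / k ∈ fdom Φ) :
    eexp P (fun ω => Φ (tri A B x₁ x₂ x₃ ω / k)) =
      ((P.real A * (Φ (x₁ / k)).toReal + P.real B * (Φ (x₂ / k)).toReal
        + (1 - P.real A - P.real B) * (Φ (x₃ / k)).toReal : ℝ) : EReal) := by
  rw [← eexp_tri P A B hA hB hd, ← fdom_coe hΦ h0 _ h₁, ← fdom_coe hΦ h0 _ h₂,
    ← fdom_coe hΦ h0 _ h₃, tri_comp A B x₁ x₂ x₃ (fun x => Φ (x / k))]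

lemma fdom_eventually {Φ : ℝ → EReal} (hΦ : IsOrliczFunction Φ) (h0 : Φ 0 ≠ ⊥) (x : ℝ)
    (hx : x ∈ fdom Φ) (ε : ℝ) (hε : 0 < ε) :
    ∀ᶠ k in nhdsWithin (1:ℝ) (Ioi 1), (Φ x).toReal - ε < (Φ (x / k)).toReal := by
  rcases hx.1.eq_or_lt with h | h
  · refine Eventually.of_forall fun k => ?_
    rw [← h, zero_div]; linarith
  · obtain ⟨y, hy0, hyx, hy⟩ := fdom_lc hΦ h0 x hx h ε hε
    have hc : ContinuousAt (fun k : ℝ => x / k) 1 := by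
      apply ContinuousAt.div <;> first | fun_prop | norm_num
    have h1 : ∀ᶠ k in nhds (1:ℝ), y < x / k :=
      hc.eventually (lt_mem_nhds (by simpa using hyx))
    filter_upwards [h1.filter_mono nhdsWithin_le_nhds, eventually_mem_nhdsWithin] with k hk hk1
    have hk1' : (1:ℝ) < k := hk1
    have hle : x / k ≤ x := div_le_self h.le hk1'.le
    exact hy.trans_le (fdom_mono hΦ h0 y _ hy0 hk.le
      (fdom_down hΦ _ x (by positivity) hle hx))

lemma premium_iff (P : Measure Ω) [IsProbabilityMeasure P] {Φ : ℝ → EReal} (hΦ : IsOrliczFunction Φ)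
    (h0 : Φ 0 ≠ ⊥) (A B : Set Ω) (hA : MeasurableSet A)
    (hB : MeasurableSet B) (hd : Disjoint A B) (x₁ x₂ x₃ : ℝ)
    (h₁ : x₁ ∈ fdom Φ) (h₂ : x₂ ∈ fdom Φ) (h₃ : x₃ ∈ fdom Φ) :
    orliczPremium P Φ (tri A B x₁ x₂ x₃) ≤ 1 ↔
      P.real A * (Φ x₁).toReal + P.real B * (Φ x₂).toReal
        + (1 - P.real A - P.real B) * (Φ x₃).toReal ≤ 1 := by
  have hC : 0 ≤ 1 - P.real A - P.real B := by
    rw [← real_compl_union P A B hA hB hd]; exact measureReal_nonneg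
  have hPA : 0 ≤ P.real A := measureReal_nonneg
  have hPB : 0 ≤ P.real B := measureReal_nonneg
  unfold orliczPremium
  rw [if_neg (fun h => h0 h.1)]
  have hbdd : BddBelow {k : ℝ | 0 < k ∧ eexp P (fun ω => Φ (tri A B x₁ x₂ x₃ ω / k)) ≤ 1} :=
    ⟨0, fun k hk => hk.1.le⟩
  constructor
  · intro hle
    apply le_of_forall_pos_le_add
    intro ε hε
    obtain ⟨k, ⟨⟨hk1, hk2⟩, hk3⟩, hk⟩ := ((((fdom_eventually hΦ h0 x₁ h₁ ε hε).and
      (fdom_eventually hΦ h0 x₂ h₂ ε hε)).and (fdom_eventually hΦ h0 x₃ h₃ ε hε)).and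
        eventually_mem_nhdsWithin).exists
    have hk1' : (1:ℝ) < k := hk
    have hk0 : 0 < k := by linarith
    have hdiv : ∀ x ∈ fdom Φ, x / k ∈ fdom Φ := fun x hx =>
      fdom_down hΦ _ x (div_nonneg hx.1 hk0.le) (div_le_self hx.1 hk1'.le) hx
    have hne : {k : ℝ | 0 < k ∧ eexp P (fun ω => Φ (tri A B x₁ x₂ x₃ ω / k)) ≤ 1}.Nonempty := by
      have hs : 0 < 1 + x₁ + x₂ + x₃ := by linarith [h₁.1, h₂.1, h₃.1]
      have hb : ∀ x, 0 ≤ x → x ≤ 1 + x₁ + x₂ + x₃ →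
          x / (1 + x₁ + x₂ + x₃) ∈ fdom Φ ∧ (Φ (x / (1 + x₁ + x₂ + x₃))).toReal ≤ 1 :=
        fun x hx hx1 => fdom_le_one hΦ h0 _ (div_nonneg hx hs.le) ((div_le_one hs).mpr hx1)
      have b1 := hb x₁ h₁.1 (by linarith [h₁.1, h₂.1, h₃.1])
      have b2 := hb x₂ h₂.1 (by linarith [h₁.1, h₂.1, h₃.1])
      have b3 := hb x₃ h₃.1 (by linarith [h₁.1, h₂.1, h₃.1])
      refine ⟨1 + x₁ + x₂ + x₃, hs, ?_⟩
      rw [eexp_phi P hΦ h0 A B hA hB hd _ _ _ _ b1.1 b2.1 b3.1]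
      have m1 := mul_le_mul_of_nonneg_left b1.2 hPA
      have m2 := mul_le_mul_of_nonneg_left b2.2 hPB
      have m3 := mul_le_mul_of_nonneg_left b3.2 hC
      rw [← EReal.coe_one, EReal.coe_le_coe_iff]
      linarith
    obtain ⟨k', ⟨hk'0, hk'⟩, hlt⟩ := exists_lt_of_csInf_lt hne (hle.trans_lt hk1')
    have hm := eexp_mono P (fun ω => Φ (tri A B x₁ x₂ x₃ ω / k))
      (fun ω => Φ (tri A B x₁ x₂ x₃ ω / k')) fun ω => by
        have hn : 0 ≤ tri A B x₁ x₂ x₃ ω := by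
          unfold tri
          split_ifs
          exacts [h₁.1, h₂.1, h₃.1]
        exact hΦ.mono _ _ (div_nonneg hn hk0.le) (div_le_div_of_nonneg_left hn hk'0 hlt.le)
    have hm' := hm.trans hk'
    rw [eexp_phi P hΦ h0 A B hA hB hd _ _ _ _ (hdiv _ h₁) (hdiv _ h₂) (hdiv _ h₃),
      ← EReal.coe_one, EReal.coe_le_coe_iff] at hm'
    have m1 := mul_le_mul_of_nonneg_left hk1.le hPA
    have m2 := mul_le_mul_of_nonneg_left hk2.le hPB
    have m3 := mul_le_mul_of_nonneg_left hk3.le hC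
    linarith
  · intro hle
    refine csInf_le hbdd ⟨one_pos, ?_⟩
    rw [eexp_phi P hΦ h0 A B hA hB hd _ _ _ _ (by simpa using h₁) (by simpa using h₂)
      (by simpa using h₃)]
    simp only [div_one]
    exact_mod_cast hle

lemma mem_tri (P : Measure Ω) (A B : Set Ω) (hA : MeasurableSet A)
    (hB : MeasurableSet B) (x₁ x₂ x₃ : ℝ) (h₁ : 0 ≤ x₁) (h₂ : 0 ≤ x₂) (h₃ : 0 ≤ x₃) :
    MemLinftyPlus P (tri A B x₁ x₂ x₃) := by
  refine ⟨measurable_tri A B hA hB _ _ _, ae_of_all _ fun ω => ?_, x₁ + x₂ + x₃,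
    ae_of_all _ fun ω => ?_⟩ <;> unfold tri <;> split_ifs <;> linarith

lemma core_of (P : Measure Ω) [IsProbabilityMeasure P] (hP : AllMass P)
    (Φ : ℝ → EReal) (hΦ : IsOrliczFunction Φ) (h0 : Φ 0 ≠ ⊥)
    (hu1 : ∃ u₁ : ℝ, 0 ≤ u₁ ∧ u₁ < 1 ∧ Φ u₁ < 1)
    (hu2 : ∃ u₂ : ℝ, 1 < u₂ ∧ Φ u₂ < ⊤)
    (hconvH : ∀ X Y : Ω → ℝ, MemLinftyPlus P X → MemLinftyPlus P Y →
      ∀ a ∈ Set.Ioo (0 : ℝ) 1,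
        orliczPremium P Φ (fun ω => a * X ω + (1 - a) * Y ω) ≤
          a * orliczPremium P Φ X + (1 - a) * orliczPremium P Φ Y) :
    OCore P (fun x => (Φ x).toReal - 1) (fdom Φ) where
  mass := hP
  nonneg := fun x hx => hx.1
  down := fdom_down hΦ
  mono := fun x y hx hxy hy => by
    have := fdom_mono hΦ h0 x y hx hxy hy
    linarith
  lc := fun x hx hx0 ε hε => by
    obtain ⟨y, h1, h2, h3⟩ := fdom_lc hΦ h0 x hx hx0 ε hε
    exact ⟨y, h1, h2, by linarith⟩
  np := fun x hx hx1 => by linarith [(fdom_le_one hΦ h0 x hx hx1).2]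
  pos := fun x hx hx1 => by
    have := hΦ.one_lt x hx1
    rw [fdom_coe hΦ h0 x hx] at this
    have : 1 < (Φ x).toReal := by exact_mod_cast this
    linarith
  exu1 := by
    obtain ⟨u, hu0, hu1, hu⟩ := hu1
    refine ⟨u, hu0, hu1, ?_⟩
    rw [fdom_coe hΦ h0 u (fdom_le_one hΦ h0 u hu0 hu1.le).1] at hu
    have : (Φ u).toReal < 1 := by exact_mod_cast hu
    linarith
  exu2 := by
    obtain ⟨u, hu1, hu⟩ := hu2
    exact ⟨u, ⟨by linarith, hu⟩, hu1⟩
  acc := by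
    intro A B hA hB hd a ha0 ha1 x₁ hx₁ x₂ hx₂ x₃ hx₃ y₁ hy₁ y₂ hy₂ y₃ hy₃ hx hy
    have hcomb : ∀ x ∈ fdom Φ, ∀ y ∈ fdom Φ, a * x + (1 - a) * y ∈ fdom Φ := by
      intro x hx y hy
      have hn : 0 ≤ a * x + (1 - a) * y :=
        add_nonneg (mul_nonneg ha0.le hx.1) (mul_nonneg (by linarith) hy.1)
      rcases le_total x y with h | h
      · exact fdom_down hΦ _ y hn (by nlinarith) hy
      · exact fdom_down hΦ _ x hn (by nlinarith) hx
    have p1 := (premium_iff P hΦ h0 A B hA hB hd x₁ x₂ x₃ hx₁ hx₂ hx₃).mpr (by linarith)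
    have p2 := (premium_iff P hΦ h0 A B hA hB hd y₁ y₂ y₃ hy₁ hy₂ hy₃).mpr (by linarith)
    have p3 := hconvH _ _ (mem_tri P A B hA hB x₁ x₂ x₃ hx₁.1 hx₂.1 hx₃.1)
      (mem_tri P A B hA hB y₁ y₂ y₃ hy₁.1 hy₂.1 hy₃.1) a ⟨ha0, ha1⟩
    have e : (fun ω => a * tri A B x₁ x₂ x₃ ω + (1 - a) * tri A B y₁ y₂ y₃ ω) =
        tri A B (a * x₁ + (1 - a) * y₁) (a * x₂ + (1 - a) * y₂) (a * x₃ + (1 - a) * y₃) := by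
      funext ω
      unfold tri
      split_ifs <;> rfl
    rw [e] at p3
    have p4 := (premium_iff P hΦ h0 A B hA hB hd _ _ _ (hcomb _ hx₁ _ hy₁) (hcomb _ hx₂ _ hy₂)
      (hcomb _ hx₃ _ hy₃)).mp (p3.trans (by nlinarith))
    linarith

/-- on a nonatomic probability space, if there exist `u₁ < 1` with
`Φ(u₁) < 1` and `u₂ > 1` with `Φ(u₂) < +∞`, and `H_Φ` is convex, then `Φ` is convex
on the set where it is finite. -/
theorem orliczFunction_convex_of_premium_convex
    (P : Measure Ω) [IsProbabilityMeasure P]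
    (hP : ∀ p : ℝ, 0 ≤ p → p ≤ 1 →
      ∃ A : Set Ω, MeasurableSet A ∧ P A = ENNReal.ofReal p)
    (Φ : ℝ → EReal) (hΦ : IsOrliczFunction Φ)
    (hu1 : ∃ u₁ : ℝ, 0 ≤ u₁ ∧ u₁ < 1 ∧ Φ u₁ < 1)
    (hu2 : ∃ u₂ : ℝ, 1 < u₂ ∧ Φ u₂ < ⊤)
    (hconvH : ∀ X Y : Ω → ℝ, MemLinftyPlus P X → MemLinftyPlus P Y →
      ∀ a ∈ Set.Ioo (0 : ℝ) 1,
        orliczPremium P Φ (fun ω => a * X ω + (1 - a) * Y ω) ≤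
          a * orliczPremium P Φ X + (1 - a) * orliczPremium P Φ Y) :
    ∀ x y : ℝ, 0 ≤ x → 0 ≤ y → Φ x < ⊤ → Φ y < ⊤ →
      ∀ a ∈ Set.Ioo (0 : ℝ) 1,
        Φ (a * x + (1 - a) * y) ≤
          eadd ((a : EReal) * Φ x) (((1 - a : ℝ) : EReal) * Φ y) := by
  have hP' : AllMass P := by
    intro p hp0 hp1
    obtain ⟨A, hA, hPA⟩ := hP p hp0 hp1
    exact ⟨A, hA, by rw [Measure.real, hPA, ENNReal.toReal_ofReal hp0]⟩
  have h0 := zero_ne_bot P hP' Φ hΦ hconvH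
  have hcore := core_of P hP' Φ hΦ h0 hu1 hu2 hconvH
  intro x y hx hy hxt hyt a ha
  have hxD : x ∈ fdom Φ := ⟨hx, hxt⟩
  have hyD : y ∈ fdom Φ := ⟨hy, hyt⟩
  have hn : 0 ≤ a * x + (1 - a) * y :=
    add_nonneg (mul_nonneg ha.1.le hx) (mul_nonneg (by linarith [ha.2]) hy)
  have hmD : a * x + (1 - a) * y ∈ fdom Φ := by
    rcases le_total x y with h | h
    · exact fdom_down hΦ _ y hn (by nlinarith [ha.1, ha.2]) hyD
    · exact fdom_down hΦ _ x hn (by nlinarith [ha.1, ha.2]) hxD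
  have key : (Φ (a * x + (1 - a) * y)).toReal ≤ a * (Φ x).toReal + (1 - a) * (Φ y).toReal := by
    rcases lt_trichotomy x y with h | rfl | h
    · have := hcore.convex x y a hx hyD h ha.1 ha.2
      linarith
    · have e : a * x + (1 - a) * x = x := by ring
      rw [e]; linarith
    · have := hcore.convex y x (1 - a) hy hxD h (by linarith [ha.2]) (by linarith [ha.1])
      have e : (1 - a) * y + (1 - (1 - a)) * x = a * x + (1 - a) * y := by ring
      rw [e] at this
      linarith
  rw [fdom_coe hΦ h0 _ hmD, fdom_coe hΦ h0 x hxD, fdom_coe hΦ h0 y hyD, ← EReal.coe_mul,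
    ← EReal.coe_mul]
  unfold eadd
  rw [if_neg (by
    rintro (⟨h, _⟩ | ⟨h, _⟩)
    · first | exact EReal.coe_ne_top _ h | exact EReal.coe_ne_bot _ h
    · first | exact EReal.coe_ne_top _ h | exact EReal.coe_ne_bot _ h), ← EReal.coe_add, EReal.coe_le_coe_iff]
  exact key
end
end

section
/- Let ρ : L∞₊₊ → (0,∞) be a geometrically convex return risk measure satisfying the lower-bounded Fatou property. Then for every X ∈ L∞₊₊, ρ(X) = sup over probability measures Q on (Ω, F) with Q ≪ P of α(Q)·exp(E_Q[log X]), where α(Q) := (sup_{Y ∈ B_ρ} exp(E_Q[log Y]))^{-1} and B_ρ := {Y ∈ L∞₊₊ : ρ(Y) ≤ 1} is the multiplicative acceptance set of ρ. -/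
open MeasureTheory Filter Set
open scoped ENNReal

noncomputable section

variable {Ω : Type*} [MeasurableSpace Ω]

lemma hilbert_minimax {H : Type*} [NormedAddCommGroup H] [InnerProductSpace ℝ H] [CompleteSpace H]
    (K V : Set H) (hKne : K.Nonempty) (hK : Convex ℝ K) (hKc : IsClosed K)
    (hKb : Bornology.IsBounded K) (hV : Convex ℝ V) (a : ℝ)
    (h : ∀ x ∈ K, ∃ v ∈ V, a < inner ℝ v x) :
    ∃ v ∈ V, ∀ x ∈ K, a < inner ℝ v x := by
  let T : H → WeakDual ℝ H := fun x => StrongDual.toWeakDual (InnerProductSpace.toDual ℝ H x)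
  have hT : ∀ x y, (T x) y = inner ℝ x y := fun x y => rfl
  have hTadd : ∀ x y, T (x + y) = T x + T y := by intro x y; simp [T]
  have hTsmul : ∀ (c : ℝ) x, T (c • x) = c • T x := by intro x y; simp [T]
  have hTsurj : Function.Surjective T := fun f => by
    refine ⟨(InnerProductSpace.toDual ℝ H).symm (WeakDual.toStrongDual f), ?_⟩
    simp [T]
  have hTinj : Function.Injective T := by
    intro x y hxy
    exact (InnerProductSpace.toDual ℝ H).injective (StrongDual.toWeakDual.injective hxy)
  have hcl : IsClosed (T '' K) := by
    rw [← isOpen_compl_iff, isOpen_iff_mem_nhds]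
    intro f hf
    obtain ⟨x, rfl⟩ := hTsurj f
    have hx : x ∉ K := fun hx => hf ⟨x, hx, rfl⟩
    obtain ⟨g, u, hg, hu⟩ := geometric_hahn_banach_closed_point hK hKc hx
    let z := (InnerProductSpace.toDual ℝ H).symm g
    have hz : ∀ y, g y = inner ℝ y z := fun y => by
      rw [real_inner_comm]; simp [z]
    have ho : IsOpen {φ : WeakDual ℝ H | u < φ z} :=
      isOpen_lt continuous_const (WeakDual.eval_continuous z)
    refine Filter.mem_of_superset (ho.mem_nhds ?_) ?_
    · change u < T x z
      rw [hT, ← hz]; exact hu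
    · rintro φ hφ ⟨y, hy, rfl⟩
      have h1 : u < T y z := hφ
      rw [hT, ← hz] at h1
      exact absurd (hg y hy) (not_lt.mpr h1.le)
  have hbd : Bornology.IsBounded (T '' K) := by
    have := (InnerProductSpace.toDual ℝ H).lipschitz.isBounded_image hKb
    rw [← WeakDual.isBounded_toWeakDual_preimage_iff_isBounded]
    convert this using 1
    ext f
    constructor
    · rintro ⟨x, hx, h⟩
      exact ⟨x, hx, StrongDual.toWeakDual.injective h⟩
    · rintro ⟨x, hx, h⟩
      exact ⟨x, hx, by simp [T, h]⟩
  have hcomp := WeakDual.isCompact_of_bounded_of_closed hbd hcl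
  have hconv : Convex ℝ (T '' K) := by
    rintro _ ⟨x, hx, rfl⟩ _ ⟨y, hy, rfl⟩ p q hp hq hpq
    exact ⟨p • x + q • y, hK hx hy hp hq hpq, by rw [hTadd, hTsmul, hTsmul]⟩
  obtain ⟨s, hs⟩ := hcomp.elim_finite_subcover (fun v : V => {φ : WeakDual ℝ H | a < φ v})
    (fun v => isOpen_lt continuous_const (WeakDual.eval_continuous (v : H))) (by
      rintro _ ⟨x, hx, rfl⟩
      obtain ⟨v, hv, hav⟩ := h x hx
      refine mem_iUnion.2 ⟨⟨v, hv⟩, ?_⟩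
      change a < T x v
      rw [hT, real_inner_comm]; exact hav)
  obtain ⟨v, hv, hvv⟩ := Sion.exists_lt_iInf_of_lt_iInf_of_finite (β := ℝ) (X := T '' K) (Y := V)
    (f := fun φ v => φ v) (hKne.image T) hcomp
    (fun v _ => (WeakDual.eval_continuous v).lowerSemicontinuous.lowerSemicontinuousOn _)
    (fun v _ => by
      refine ConvexOn.quasiconvexOn ⟨hconv, ?_⟩
      intro f _ g _ p q _ _ _
      exact le_of_eq rfl)
    hV
    (fun f _ => (ContinuousLinearMap.continuous (WeakDual.toStrongDual f)).upperSemicontinuous.upperSemicontinuousOn _)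
    (fun f _ => by
      refine ConcaveOn.quasiconcaveOn ⟨hV, ?_⟩
      intro x _ y _ p q _ _ _
      simp)
    hconv (s := Subtype.val '' (s : Set V)) ((s.finite_toSet).image _) (by
      rintro _ ⟨v, _, rfl⟩; exact v.2) (t := a) (by
      intro f hf
      obtain ⟨v, hv, h⟩ := mem_iUnion₂.1 (hs hf)
      exact ⟨v, ⟨v, hv, rfl⟩, h⟩)
  refine ⟨v, hv, fun x hx => ?_⟩
  have := hvv (T x) ⟨x, hx, rfl⟩
  rw [real_inner_comm]
  exact this

def BddMeas {Ω : Type*} [MeasurableSpace Ω] (P : Measure Ω) (f : Ω → ℝ) : Prop :=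
  Measurable f ∧ ∃ C : ℝ, ∀ᵐ ω ∂P, |f ω| ≤ C

structure GoodSet {Ω : Type*} [MeasurableSpace Ω] (P : Measure Ω) (S : (Ω → ℝ) → Prop) (r0 : ℝ) :
    Prop where
  mono : ∀ f g, BddMeas P f → BddMeas P g → (∀ᵐ ω ∂P, f ω ≤ g ω) → S f → S g
  conv : ∀ f g, BddMeas P f → BddMeas P g → S f → S g → ∀ p q : ℝ, 0 ≤ p → 0 ≤ q → p + q = 1 →
    S (fun ω => p * f ω + q * g ω)
  closed : ∀ (f : Ω → ℝ) (fn : ℕ → Ω → ℝ) (C : ℝ), BddMeas P f → (∀ n, Measurable (fn n)) →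
    (∀ n, ∀ᵐ ω ∂P, |fn n ω| ≤ C) → (∀ᵐ ω ∂P, Tendsto (fun n => fn n ω) atTop (nhds (f ω))) →
    (∀ n, S (fn n)) → S f
  pos : 0 < r0
  small : ∀ f, BddMeas P f → (∀ᵐ ω ∂P, f ω ≤ r0) → ¬ S f
  nonempty : ∃ c : ℝ, S (fun _ => c)

def levelK {Ω : Type*} [MeasurableSpace Ω] (P : Measure Ω) (S : (Ω → ℝ) → Prop) (r : ℝ) :
    Set (Lp ℝ 2 P) :=
  {N | (∀ᵐ ω ∂P, 0 ≤ N ω ∧ N ω ≤ r) ∧ S N}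

lemma levelK_bdd {Ω : Type*} [MeasurableSpace Ω] {P : Measure Ω} {r : ℝ}
    {N : Lp ℝ 2 P} (hN : ∀ᵐ ω ∂P, 0 ≤ N ω ∧ N ω ≤ r) : BddMeas P N :=
  ⟨(Lp.stronglyMeasurable N).measurable, r, by
    filter_upwards [hN] with ω h
    rw [abs_of_nonneg h.1]; exact h.2⟩

lemma levelK_convex {Ω : Type*} [MeasurableSpace Ω] {P : Measure Ω} {S : (Ω → ℝ) → Prop} {r0 : ℝ}
    (hS : GoodSet P S r0) (r : ℝ) : Convex ℝ (levelK P S r) := by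
  intro N hN M hM p q hp hq hpq
  have e : ∀ᵐ ω ∂P, (p • N + q • M : Lp ℝ 2 P) ω = p * N ω + q * M ω := by
    filter_upwards [Lp.coeFn_add (p • N) (q • M), Lp.coeFn_smul p N, Lp.coeFn_smul q M]
      with ω h1 h2 h3
    rw [h1, Pi.add_apply, h2, h3]; rfl
  have hb : ∀ᵐ ω ∂P, 0 ≤ (p • N + q • M : Lp ℝ 2 P) ω ∧ (p • N + q • M : Lp ℝ 2 P) ω ≤ r := by
    filter_upwards [e, hN.1, hM.1] with ω h1 h2 h3
    rw [h1]
    refine ⟨by nlinarith [h2.1, h3.1], ?_⟩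
    have : r = p * r + q * r := by rw [← add_mul, hpq, one_mul]
    rw [this]
    exact add_le_add (mul_le_mul_of_nonneg_left h2.2 hp) (mul_le_mul_of_nonneg_left h3.2 hq)
  have hbm := levelK_bdd hb
  refine ⟨hb, ?_⟩
  have bN := levelK_bdd hN.1
  have bM := levelK_bdd hM.1
  refine hS.mono _ _ ⟨(bN.1.const_mul p).add (bM.1.const_mul q), ?_⟩ hbm ?_
    (hS.conv N M bN bM hN.2 hM.2 p q hp hq hpq)
  · obtain ⟨C, hC⟩ := hbm.2
    refine ⟨C, ?_⟩
    filter_upwards [hC, e] with ω h1 h2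
    simpa [← h2] using h1
  · filter_upwards [e] with ω h2
    exact h2.symm.le

lemma levelK_closed {Ω : Type*} [MeasurableSpace Ω] {P : Measure Ω} {S : (Ω → ℝ) → Prop} {r0 : ℝ}
    (hS : GoodSet P S r0) (r : ℝ) : IsClosed (levelK P S r) := by
  rw [← isSeqClosed_iff_isClosed]
  intro Nn N hNn hlim
  obtain ⟨ns, -, hns⟩ := (tendstoInMeasure_of_tendsto_Lp hlim).exists_seq_tendsto_ae
  have hb : ∀ᵐ ω ∂P, 0 ≤ N ω ∧ N ω ≤ r := by
    have := ae_all_iff.2 (fun n => (hNn n).1)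
    filter_upwards [hns, this] with ω h1 h2
    exact ⟨ge_of_tendsto' h1 fun i => (h2 (ns i)).1, le_of_tendsto' h1 fun i => (h2 (ns i)).2⟩
  refine ⟨hb, hS.closed N (fun i => Nn (ns i)) r (levelK_bdd hb)
    (fun n => (Lp.stronglyMeasurable _).measurable) ?_ hns fun n => (hNn _).2⟩
  intro n
  filter_upwards [(hNn (ns n)).1] with ω h
  rw [abs_of_nonneg h.1]; exact h.2

lemma levelK_bounded {Ω : Type*} [MeasurableSpace Ω] {P : Measure Ω} [IsProbabilityMeasure P]
    {S : (Ω → ℝ) → Prop} (r : ℝ) : Bornology.IsBounded (levelK P S r) := by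
  rw [isBounded_iff_forall_norm_le]
  refine ⟨_, fun N hN => Lp.norm_le_of_ae_bound (f := N) (abs_nonneg r) ?_⟩
  filter_upwards [hN.1] with ω h
  rw [Real.norm_eq_abs, abs_of_nonneg h.1]; exact h.2.trans (le_abs_self r)

lemma Lp2_smul_nonneg {Ω : Type*} [MeasurableSpace Ω] {P : Measure Ω} {p : ℝ} (hp : 0 ≤ p)
    {v : Lp ℝ 2 P} (hv : 0 ≤ v) : 0 ≤ p • v := by
  rw [← Lp.coeFn_nonneg]
  filter_upwards [Lp.coeFn_smul p v, (Lp.coeFn_nonneg v).2 hv] with ω h1 h2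
  rw [h1]
  exact mul_nonneg hp h2

lemma step_lemma {Ω : Type*} [MeasurableSpace Ω] {P : Measure Ω} [IsProbabilityMeasure P]
    {S : (Ω → ℝ) → Prop} {r0 : ℝ}
    (hS : GoodSet P S r0) (r r' η : ℝ) (hη : 0 < η) (hr : 0 < r) (hηr : 1 < η * r) (w : Lp ℝ 2 P)
    (hw0 : 0 ≤ w) (hw : ∀ N ∈ levelK P S r, 1 < inner ℝ w N) :
    ∃ v : Lp ℝ 2 P, 0 ≤ v ∧ ∫ ω, v ω ∂P ≤ η ∧ ∀ N ∈ levelK P S r', 1 < inner ℝ (w + v) N := by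
  have hintg : ∀ v : Lp ℝ 2 P, Integrable v P := fun v => (Lp.memLp v).integrable (by norm_num)
  have z1 : ∫ ω, (0 : Lp ℝ 2 P) ω ∂P = 0 := by
    rw [integral_congr_ae (Lp.coeFn_zero ℝ 2 P)]; simp
  by_cases hne : (levelK P S r').Nonempty
  swap
  · exact ⟨0, le_rfl, by rw [z1]; exact hη.le, fun N hN => absurd ⟨N, hN⟩ hne⟩
  let V : Set (Lp ℝ 2 P) := {u | 0 ≤ u - w ∧ ∫ ω, (u - w : Lp ℝ 2 P) ω ∂P ≤ η}
  have hV : Convex ℝ V := by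
    intro x hx y hy p q hp hq hpq
    have e : p • x + q • y - w = p • (x - w) + q • (y - w) := by
      have : w = (p + q) • w := by rw [hpq, one_smul]
      nth_rewrite 1 [this]
      module
    refine ⟨?_, ?_⟩
    · rw [e]
      exact add_nonneg (Lp2_smul_nonneg hp hx.1) (Lp2_smul_nonneg hq hy.1)
    · rw [e]
      have e2 : ∀ᵐ ω ∂P, (p • (x - w) + q • (y - w) : Lp ℝ 2 P) ω
          = p * (x - w : Lp ℝ 2 P) ω + q * (y - w : Lp ℝ 2 P) ω := by
        filter_upwards [Lp.coeFn_add (p • (x - w)) (q • (y - w)), Lp.coeFn_smul p (x - w),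
          Lp.coeFn_smul q (y - w)] with ω h1 h2 h3
        rw [h1, Pi.add_apply, h2, h3]; rfl
      rw [integral_congr_ae e2, integral_add ((hintg _).const_mul p) ((hintg _).const_mul q),
        integral_const_mul, integral_const_mul]
      have : η = p * η + q * η := by rw [← add_mul, hpq, one_mul]
      rw [this]
      exact add_le_add (mul_le_mul_of_nonneg_left hx.2 hp) (mul_le_mul_of_nonneg_left hy.2 hq)
  obtain ⟨u, hu, huu⟩ := hilbert_minimax (levelK P S r') V hne (levelK_convex hS r')
    (levelK_closed hS r') (levelK_bounded r') hV 1 (by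
    intro N hN
    by_cases hNr : ∀ᵐ ω ∂P, N ω ≤ r
    · refine ⟨w, ⟨by simp, by rw [sub_self, z1]; exact hη.le⟩, hw N ⟨?_, hN.2⟩⟩
      filter_upwards [hN.1, hNr] with ω h1 h2 using ⟨h1.1, h2⟩
    · let B : Set Ω := {ω | r < N ω}
      have hB : MeasurableSet B := measurableSet_lt measurable_const
        (Lp.stronglyMeasurable N).measurable
      have hPB : P B ≠ 0 := by
        intro h0
        apply hNr
        rw [ae_iff]
        simpa [B] using h0
      have hPB' : 0 < P.real B := ENNReal.toReal_pos hPB (measure_ne_top _ _)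
      let v : Lp ℝ 2 P := indicatorConstLp 2 hB (measure_ne_top P B) (η / P.real B)
      have hv0 : 0 ≤ v := by
        rw [← Lp.coeFn_nonneg]
        filter_upwards [indicatorConstLp_coeFn (p := 2) (hs := hB) (hμs := measure_ne_top P B)
          (c := η / P.real B)] with ω h
        rw [h]
        exact indicator_nonneg (fun _ _ => by positivity) ω
      refine ⟨w + v, ⟨by simpa using hv0, ?_⟩, ?_⟩
      · rw [add_sub_cancel_left, integral_indicatorConstLp]
        rw [smul_eq_mul, mul_div_cancel₀ _ hPB'.ne']
      · rw [inner_add_left]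
        have h1 : 0 ≤ inner ℝ w N := by
          rw [L2.inner_def]
          apply integral_nonneg_of_ae
          filter_upwards [(Lp.coeFn_nonneg w).2 hw0, hN.1] with ω h2 h3
          exact mul_nonneg h3.1 h2
        have h2 : η * r ≤ inner ℝ v N := by
          rw [L2.inner_indicatorConstLp_eq_inner_setIntegral]
          have : r * P.real B ≤ ∫ ω in B, N ω ∂P := by
            have := setIntegral_mono_on (μ := P) (s := B) (f := fun _ => r) (g := N)
              (integrable_const _).integrableOn (hintg N).integrableOn hB (fun ω h => le_of_lt h)
            simpa [mul_comm] using this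
          change _ ≤ (∫ ω in B, N ω ∂P) * (η / P.real B)
          calc η * r = (r * P.real B) * (η / P.real B) := by field_simp
            _ ≤ _ := mul_le_mul_of_nonneg_right this (by positivity)
        linarith)
  exact ⟨u - w, hu.1, hu.2, by simpa using huu⟩

lemma exists_weights {Ω : Type*} [MeasurableSpace Ω] {P : Measure Ω} [IsProbabilityMeasure P]
    {S : (Ω → ℝ) → Prop} {r0 : ℝ} (hS : GoodSet P S r0) :
    ∃ w : ℕ → Lp ℝ 2 P, (∀ n, 0 ≤ w n) ∧ (∀ n, w n ≤ w (n + 1)) ∧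
      (∀ n, ∫ ω, w n ω ∂P ≤ 4 / r0) ∧
      ∀ n, ∀ N ∈ levelK P S (r0 * 4 ^ n), 1 < inner ℝ (w n) N := by
  have hr0 := hS.pos
  have hintg : ∀ v : Lp ℝ 2 P, Integrable v P := fun v => (Lp.memLp v).integrable (by norm_num)
  let Inv : ℕ → Lp ℝ 2 P → Prop := fun n w => 0 ≤ w ∧ ∫ ω, w ω ∂P ≤ 4 / r0 * (1 - (1 / 2) ^ n) ∧
    ∀ N ∈ levelK P S (r0 * 4 ^ n), 1 < inner ℝ w N
  have step : ∀ n (w : {w // Inv n w}), ∃ w' : {w // Inv (n + 1) w}, w.1 ≤ w'.1 := by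
    rintro n ⟨w, h0, h1, h2⟩
    obtain ⟨v, hv0, hv1, hv2⟩ := step_lemma hS (r0 * 4 ^ n) (r0 * 4 ^ (n + 1))
      (2 / r0 * (1 / 2) ^ n) (by positivity) (by positivity) (by
        have : 2 / r0 * (1 / 2) ^ n * (r0 * 4 ^ n) = 2 * 2 ^ n := by
          have : (4 : ℝ) ^ n = 2 ^ n * 2 ^ n := by rw [← mul_pow]; norm_num
          rw [this, one_div, inv_pow]
          field_simp
        rw [this]
        have : (1 : ℝ) ≤ 2 ^ n := one_le_pow₀ (by norm_num)
        linarith) w h0 h2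
    refine ⟨⟨w + v, add_nonneg h0 hv0, ?_, hv2⟩, le_add_of_nonneg_right hv0⟩
    rw [integral_congr_ae (Lp.coeFn_add w v)]
    change ∫ ω, w ω + v ω ∂P ≤ _
    rw [integral_add (hintg _) (hintg _)]
    calc _ ≤ 4 / r0 * (1 - (1 / 2) ^ n) + 2 / r0 * (1 / 2) ^ n := add_le_add h1 hv1
      _ = _ := by rw [pow_succ]; ring
  choose F hF using step
  have hz : Inv 0 0 := by
    refine ⟨le_rfl, ?_, ?_⟩
    · rw [integral_congr_ae (Lp.coeFn_zero ℝ 2 P)]; simp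
    · intro N hN
      refine absurd hN.2 (hS.small N (levelK_bdd hN.1) ?_)
      filter_upwards [hN.1] with ω h
      simpa using h.2
  let W : ∀ n, {w // Inv n w} := fun n => Nat.rec ⟨0, hz⟩ F n
  refine ⟨fun n => (W n).1, fun n => (W n).2.1, fun n => hF n (W n), fun n => ?_,
    fun n => (W n).2.2.2⟩
  refine (W n).2.2.1.trans ?_
  have : (0 : ℝ) ≤ (1 / 2) ^ n := by positivity
  have h4 : 0 < 4 / r0 := by positivity
  nlinarith

lemma exists_dominating {Ω : Type*} [MeasurableSpace Ω] {P : Measure Ω} [IsProbabilityMeasure P]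
    {S : (Ω → ℝ) → Prop} {r0 : ℝ} (hS : GoodSet P S r0) :
    ∃ μ : Measure Ω, IsFiniteMeasure μ ∧ μ ≪ P ∧
      ∀ f, BddMeas P f → (∀ᵐ ω ∂P, 0 ≤ f ω) → S f → 1 ≤ ∫ ω, f ω ∂μ := by
  obtain ⟨w, hw0, hwm, hwi, hw⟩ := exists_weights hS
  have hr0 := hS.pos
  have hintg : ∀ v : Lp ℝ 2 P, Integrable v P := fun v => (Lp.memLp v).integrable (by norm_num)
  have hm : ∀ v : Lp ℝ 2 P, Measurable v := fun v => (Lp.stronglyMeasurable v).measurable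
  let g : Ω → ℝ≥0∞ := fun ω => ⨆ n, ENNReal.ofReal (w n ω)
  have hg : Measurable g := Measurable.iSup fun n => (hm (w n)).ennreal_ofReal
  have hgi : ∫⁻ ω, g ω ∂P ≤ ENNReal.ofReal (4 / r0) := by
    rw [lintegral_iSup' (fun n => (hm (w n)).ennreal_ofReal.aemeasurable)]
    · refine iSup_le fun n => ?_
      rw [← ofReal_integral_eq_lintegral_ofReal (hintg _) ((Lp.coeFn_nonneg _).2 (hw0 n))]
      exact ENNReal.ofReal_le_ofReal (hwi n)
    · have := ae_all_iff.2 fun n => (Lp.coeFn_le _ _).2 (hwm n)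
      filter_upwards [this] with ω h
      exact monotone_nat_of_le_succ fun n => ENNReal.ofReal_le_ofReal (h n)
  have hfin : IsFiniteMeasure (P.withDensity g) :=
    isFiniteMeasure_withDensity (hgi.trans_lt ENNReal.ofReal_lt_top).ne
  have hac : P.withDensity g ≪ P := withDensity_absolutelyContinuous P g
  refine ⟨P.withDensity g, hfin, hac, ?_⟩
  intro f hf hf0 hSf
  obtain ⟨C, hC⟩ := hf.2
  have hfL : MemLp f 2 P := MemLp.of_bound hf.1.aestronglyMeasurable C hC
  obtain ⟨n, hn⟩ : ∃ n : ℕ, C / r0 < 4 ^ n := pow_unbounded_of_one_lt _ (by norm_num)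
  have hn' : C ≤ r0 * 4 ^ n := by
    rw [div_lt_iff₀ hr0] at hn; linarith
  let N := hfL.toLp f
  have hNf : ∀ᵐ ω ∂P, N ω = f ω := hfL.coeFn_toLp
  have hNb : ∀ᵐ ω ∂P, 0 ≤ N ω ∧ N ω ≤ r0 * 4 ^ n := by
    filter_upwards [hNf, hf0, hC] with ω h1 h2 h3
    rw [h1]; exact ⟨h2, ((le_abs_self _).trans h3).trans hn'⟩
  have hN : N ∈ levelK P S (r0 * 4 ^ n) := by
    refine ⟨hNb, hS.mono f N hf (levelK_bdd hNb) ?_ hSf⟩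
    filter_upwards [hNf] with ω h using h.symm.le
  have h1 := hw n N hN
  rw [L2.inner_def] at h1
  have h1i : Integrable (fun ω => inner ℝ (w n ω) (N ω)) P := L2.integrable_inner (w n) N
  have h2 : ENNReal.ofReal 1 ≤ ∫⁻ ω, ENNReal.ofReal (f ω) ∂(P.withDensity g) := by
    calc ENNReal.ofReal 1 ≤ ENNReal.ofReal (∫ ω, inner ℝ (w n ω) (N ω) ∂P) :=
          ENNReal.ofReal_le_ofReal h1.le
      _ = ∫⁻ ω, ENNReal.ofReal (inner ℝ (w n ω) (N ω)) ∂P := by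
          apply ofReal_integral_eq_lintegral_ofReal h1i
          filter_upwards [hNb, (Lp.coeFn_nonneg _).2 (hw0 n)] with ω h1 h2
          exact mul_nonneg h1.1 h2
      _ ≤ ∫⁻ ω, g ω * ENNReal.ofReal (f ω) ∂P := by
          apply lintegral_mono_ae
          filter_upwards [hNf, hf0] with ω h3 h4
          change ENNReal.ofReal (N ω * w n ω) ≤ _
          rw [h3, mul_comm, ENNReal.ofReal_mul' h4]
          gcongr
          exact le_iSup (fun n => ENNReal.ofReal (w n ω)) n
      _ = _ := by
          rw [lintegral_withDensity_eq_lintegral_mul _ hg hf.1.ennreal_ofReal]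
          rfl
  have hfi : Integrable f (P.withDensity g) :=
    (MemLp.of_bound (p := 1) hf.1.aestronglyMeasurable C (hac.ae_le hC)).integrable le_rfl
  rw [← ofReal_integral_eq_lintegral_ofReal hfi (hac.ae_le hf0)] at h2
  by_contra hlt
  push Not at hlt
  have := (ENNReal.ofReal_lt_ofReal_iff one_pos).2 hlt
  exact absurd h2 (not_le.2 this)

lemma exists_prob {Ω : Type*} [MeasurableSpace Ω] {P : Measure Ω} [IsProbabilityMeasure P]
    {S : (Ω → ℝ) → Prop} {r0 : ℝ} (hS : GoodSet P S r0) :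
    ∃ Q : Measure Ω, IsProbabilityMeasure Q ∧ Q ≪ P ∧
      ∀ f, BddMeas P f → S f → 0 ≤ ∫ ω, f ω ∂Q := by
  obtain ⟨μ, hμ, hac, hdom⟩ := exists_dominating hS
  have hL : ∀ f, BddMeas P f → MemLp f 2 μ := fun f hf => by
    obtain ⟨C, hC⟩ := hf.2
    exact MemLp.of_bound hf.1.aestronglyMeasurable C (hac.ae_le hC)
  let A : Set (Lp ℝ 2 μ) := {Y | ∃ f, BddMeas P f ∧ S f ∧ ∀ᵐ ω ∂μ, Y ω = f ω}
  have hA : Convex ℝ A := by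
    rintro Y ⟨f, hf, hSf, hY⟩ Z ⟨g, hg, hSg, hZ⟩ p q hp hq hpq
    refine ⟨fun ω => p * f ω + q * g ω, ⟨(hf.1.const_mul p).add (hg.1.const_mul q), ?_⟩,
      hS.conv f g hf hg hSf hSg p q hp hq hpq, ?_⟩
    · obtain ⟨C, hC⟩ := hf.2
      obtain ⟨D, hD⟩ := hg.2
      refine ⟨p * C + q * D, ?_⟩
      filter_upwards [hC, hD] with ω h1 h2
      refine (abs_add_le _ _).trans ?_
      rw [abs_mul, abs_mul, abs_of_nonneg hp, abs_of_nonneg hq]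
      gcongr
    · filter_upwards [Lp.coeFn_add (p • Y) (q • Z), Lp.coeFn_smul p Y, Lp.coeFn_smul q Z, hY, hZ]
        with ω h1 h2 h3 h4 h5
      rw [h1, Pi.add_apply, h2, h3, Pi.smul_apply, Pi.smul_apply, h4, h5]; rfl
  have h1L : MemLp (fun _ : Ω => (1 : ℝ)) 2 μ := memLp_const 1
  let one : Lp ℝ 2 μ := h1L.toLp _
  let δ : ℝ := 1 / (‖one‖ + 1)
  have hδ : 0 < δ := by positivity
  have hdisj : Disjoint (Metric.ball (0 : Lp ℝ 2 μ) δ) A := by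
    rw [Set.disjoint_left]
    rintro Y hYb ⟨f, hf, hSf, hY⟩
    rw [mem_ball_zero_iff] at hYb
    have hfp : BddMeas P (fun ω => max (f ω) 0) := by
      refine ⟨hf.1.max measurable_const, ?_⟩
      obtain ⟨C, hC⟩ := hf.2
      refine ⟨C, ?_⟩
      filter_upwards [hC] with ω h
      refine le_trans ?_ h
      rw [abs_of_nonneg (le_max_right _ _)]
      exact max_le (le_abs_self _) (abs_nonneg _)
    have h1 := hdom _ hfp (ae_of_all _ fun ω => le_max_right _ _)
      (hS.mono f _ hf hfp (ae_of_all _ fun ω => le_max_left _ _) hSf)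
    have hI : inner ℝ one |Y| = ∫ ω, |Y ω| ∂μ := by
      rw [L2.inner_def]
      apply integral_congr_ae
      filter_upwards [Lp.coeFn_abs Y, h1L.coeFn_toLp] with ω h2 h3
      change (|Y| : Lp ℝ 2 μ) ω * one ω = _
      rw [h2, h3, mul_one]
    have h2 : ∫ ω, max (f ω) 0 ∂μ ≤ ∫ ω, |Y ω| ∂μ := by
      apply integral_mono_ae ((hL _ hfp).integrable (by norm_num))
        ((Lp.memLp Y).integrable (by norm_num)).abs
      filter_upwards [hY] with ω h
      simp only [h]
      exact max_le (le_abs_self _) (abs_nonneg _)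
    have h3 := real_inner_le_norm one |Y|
    rw [norm_abs_eq_norm] at h3
    have h4 : ‖one‖ * ‖Y‖ < 1 := by
      have h5 : (‖one‖ + 1) * ‖Y‖ < 1 := by
        rw [lt_div_iff₀ (by positivity)] at hYb; linarith
      nlinarith [norm_nonneg Y]
    linarith
  obtain ⟨φ, u, hφ1, hφ2⟩ := geometric_hahn_banach_open (convex_ball _ _) Metric.isOpen_ball hA hdisj
  have hu : 0 < u := by simpa using hφ1 0 (Metric.mem_ball_self hδ)
  let h : Lp ℝ 2 μ := (InnerProductSpace.toDual ℝ _).symm φ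
  have hm : Measurable h := (Lp.stronglyMeasurable h).measurable
  have hhi : Integrable h μ := (Lp.memLp h).integrable (by norm_num)
  have key : ∀ f, BddMeas P f → S f → u ≤ ∫ ω, h ω * f ω ∂μ := by
    intro f hf hSf
    have hfL := hL f hf
    have h1 := hφ2 (hfL.toLp f) ⟨f, hf, hSf, hfL.coeFn_toLp⟩
    have h2 : φ (hfL.toLp f) = inner ℝ h (hfL.toLp f) := by simp [h]
    rw [h2, L2.inner_def] at h1
    refine h1.trans (le_of_eq (integral_congr_ae ?_))
    filter_upwards [hfL.coeFn_toLp] with ω h3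
    change (hfL.toLp f) ω * h ω = _
    rw [h3, mul_comm]
  obtain ⟨c, hc⟩ := hS.nonempty
  have bc : BddMeas P (fun _ : Ω => c) := ⟨measurable_const, |c|, ae_of_all _ fun _ => le_rfl⟩
  have hcI := key _ bc hc
  rw [integral_mul_const] at hcI
  have hind : ∀ B : Set Ω, MeasurableSet B → ∀ k : ℝ, 0 ≤ k →
      u ≤ (∫ ω, h ω ∂μ) * c + k * ∫ ω in B, h ω ∂μ := by
    intro B hB k hk
    have hb : BddMeas P (fun ω => c + B.indicator (fun _ => k) ω) := by
      refine ⟨measurable_const.add (measurable_const.indicator hB), |c| + k, ae_of_all _ fun ω => ?_⟩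
      refine (abs_add_le _ _).trans ?_
      gcongr
      rw [abs_of_nonneg (indicator_nonneg (fun _ _ => hk) _)]
      exact indicator_le_self' (fun _ _ => hk) ω
    have h1 := key _ hb (hS.mono _ _ bc hb (ae_of_all _ fun ω => by
      simpa using indicator_nonneg (fun _ _ => hk) ω) hc)
    refine h1.trans (le_of_eq ?_)
    have e : ∀ ω, h ω * (c + B.indicator (fun _ => k) ω)
        = h ω * c + k * B.indicator h ω := by
      intro ω
      by_cases hω : ω ∈ B <;> simp [hω] <;> ring
    simp_rw [e]
    rw [integral_add (hhi.mul_const c) ((hhi.indicator hB).const_mul k), integral_mul_const,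
      integral_const_mul, integral_indicator hB]
  have hh0 : 0 ≤ᵐ[μ] h := by
    apply ae_nonneg_of_forall_setIntegral_nonneg hhi
    intro B hB _
    by_contra hneg
    push Not at hneg
    have hk : 0 ≤ ((∫ ω, h ω ∂μ) * c) / (-∫ ω in B, h ω ∂μ) :=
      div_nonneg (hu.le.trans hcI) (by linarith)
    have h1 := hind B hB _ hk
    have hne : (∫ ω in B, h ω ∂μ) ≠ 0 := hneg.ne
    have : ((∫ ω, h ω ∂μ) * c) / (-∫ ω in B, h ω ∂μ) * (∫ ω in B, h ω ∂μ)
      = - ((∫ ω, h ω ∂μ) * c) := by field_simp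
    linarith
  have hI0 : 0 < ∫ ω, h ω ∂μ := by
    refine lt_of_le_of_ne (integral_nonneg_of_ae hh0) fun h0 => ?_
    rw [← h0] at hcI; linarith
  let ν : Measure Ω := μ.withDensity fun ω => ENNReal.ofReal (h ω)
  have hν : ν univ = ENNReal.ofReal (∫ ω, h ω ∂μ) := by
    rw [withDensity_apply _ MeasurableSet.univ, setLIntegral_univ,
      ofReal_integral_eq_lintegral_ofReal hhi hh0]
  have hν0 : ENNReal.ofReal (∫ ω, h ω ∂μ) ≠ 0 := by simpa using hI0
  refine ⟨(ENNReal.ofReal (∫ ω, h ω ∂μ))⁻¹ • ν, ⟨?_⟩, ?_, ?_⟩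
  · rw [Measure.smul_apply, hν, smul_eq_mul, ENNReal.inv_mul_cancel hν0 ENNReal.ofReal_ne_top]
  · exact (Measure.smul_absolutelyContinuous).trans
      ((withDensity_absolutelyContinuous _ _).trans hac)
  · intro f hf hSf
    rw [integral_smul_measure]
    refine smul_nonneg ENNReal.toReal_nonneg ?_
    rw [integral_withDensity_eq_integral_toReal_smul hm.ennreal_ofReal
      (ae_of_all _ fun _ => ENNReal.ofReal_lt_top)]
    refine (hu.le.trans (key f hf hSf)).trans (le_of_eq (integral_congr_ae ?_))
    filter_upwards [hh0] with ω h1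
    rw [ENNReal.toReal_ofReal h1, smul_eq_mul]

lemma mpp_congr {Ω : Type*} [MeasurableSpace Ω] {P : Measure Ω} {A B : Ω → ℝ}
    (hA : MemLinftyPlusPlus P A) (hB : Measurable B) (h : ∀ᵐ ω ∂P, A ω = B ω) :
    MemLinftyPlusPlus P B := by
  obtain ⟨_, ⟨c, hc, h1⟩, C, h2⟩ := hA
  refine ⟨hB, ⟨c, hc, ?_⟩, C, ?_⟩
  · filter_upwards [h, h1] with ω a b
    rwa [← a]
  · filter_upwards [h, h2] with ω a b
    rwa [← a]

lemma mpp_exp {Ω : Type*} [MeasurableSpace Ω] {P : Measure Ω} {X f : Ω → ℝ}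
    (hX : MemLinftyPlusPlus P X) (hf : BddMeas P f) :
    MemLinftyPlusPlus P (fun ω => X ω * Real.exp (-f ω)) := by
  obtain ⟨hm, ⟨c, hc, h1⟩, C, h2⟩ := hX
  obtain ⟨hfm, D, hD⟩ := hf
  refine ⟨hm.mul (Real.measurable_exp.comp hfm.neg), ⟨c * Real.exp (-D), by positivity, ?_⟩,
    C * Real.exp D, ?_⟩
  · filter_upwards [h1, hD] with ω a b
    have := (abs_le.1 b).2
    gcongr
    exact hc.le.trans a
  · filter_upwards [h1, h2, hD] with ω a0 a b
    have := (abs_le.1 b).1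
    have : 0 ≤ C := (hc.le.trans a0).trans a
    gcongr
    linarith

lemma bdd_log {Ω : Type*} [MeasurableSpace Ω] {P : Measure Ω} {X : Ω → ℝ}
    (hX : MemLinftyPlusPlus P X) : BddMeas P (fun ω => Real.log (X ω)) := by
  obtain ⟨hm, ⟨c, hc, h1⟩, C, h2⟩ := hX
  refine ⟨Real.measurable_log.comp hm, |Real.log c| + |Real.log C|, ?_⟩
  filter_upwards [h1, h2] with ω a b
  have h3 := Real.log_le_log hc a
  have h4 := Real.log_le_log (hc.trans_le a) b
  rw [abs_le]
  constructor
  · linarith [neg_abs_le (Real.log c), abs_nonneg (Real.log C)]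
  · linarith [le_abs_self (Real.log C), abs_nonneg (Real.log c)]

lemma bdd_integrable {Ω : Type*} [MeasurableSpace Ω] {P Q : Measure Ω} [IsFiniteMeasure Q]
    (hQ : Q ≪ P) {f : Ω → ℝ} (hf : BddMeas P f) : Integrable f Q := by
  obtain ⟨hm, C, hC⟩ := hf
  exact (MemLp.of_bound (p := 1) hm.aestronglyMeasurable C (hQ.ae_le hC)).integrable le_rfl

lemma goodSet_of_riskMeasure {Ω : Type*} [MeasurableSpace Ω]
    (P : Measure Ω) [IsProbabilityMeasure P] (ρ : (Ω → ℝ) → ℝ)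
    (hmono : ∀ X Y : Ω → ℝ, MemLinftyPlusPlus P X → MemLinftyPlusPlus P Y →
      (∀ᵐ ω ∂P, X ω ≤ Y ω) → ρ X ≤ ρ Y)
    (hhom : ∀ X : Ω → ℝ, MemLinftyPlusPlus P X → ∀ l : ℝ, 0 < l →
      ρ (fun ω => l * X ω) = l * ρ X)
    (hpos : ∀ X : Ω → ℝ, MemLinftyPlusPlus P X → 0 < ρ X)
    (hGG : ∀ X Y : Ω → ℝ, MemLinftyPlusPlus P X → MemLinftyPlusPlus P Y →
      ∀ l ∈ Set.Ioo (0 : ℝ) 1,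
        ρ (fun ω => X ω ^ l * Y ω ^ (1 - l)) ≤ ρ X ^ l * ρ Y ^ (1 - l))
    (hFatou : ∀ (X : Ω → ℝ) (Xn : ℕ → Ω → ℝ) (k c : ℝ), 0 < c →
      MemLinftyPlusPlus P X → (∀ n, MemLinftyPlusPlus P (Xn n)) →
      (∀ n, ∀ᵐ ω ∂P, |Xn n ω| ≤ k) →
      (∀ n, ∀ᵐ ω ∂P, c ≤ Xn n ω) →
      TendstoInMeasure P Xn atTop X →
      ρ X ≤ atTop.liminf fun n => ρ (Xn n))
    (X : Ω → ℝ) (hX : MemLinftyPlusPlus P X) (t : ℝ) (ht : 0 < t) (htX : t < ρ X) :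
    GoodSet P (fun f => ρ (fun ω => X ω * Real.exp (-f ω)) ≤ t)
      ((Real.log (ρ X) - Real.log t) / 2) := by
  have hlog := Real.log_lt_log ht htX
  have hconst : ∀ c : ℝ, ρ (fun ω => X ω * Real.exp (-c)) = Real.exp (-c) * ρ X := by
    intro c
    rw [← hhom X hX _ (Real.exp_pos _)]
    simp_rw [mul_comm]
  have hXpos : ∀ᵐ ω ∂P, 0 < X ω := by
    obtain ⟨-, ⟨c, hc, h1⟩, -⟩ := hX
    filter_upwards [h1] with ω h using hc.trans_le h
  have bc : ∀ c : ℝ, BddMeas P (fun _ : Ω => c) := fun c =>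
    ⟨measurable_const, |c|, ae_of_all _ fun _ => le_rfl⟩
  refine ⟨?_, ?_, ?_, by linarith, ?_, ?_⟩
  · intro f g hf hg hfg hSf
    refine le_trans (hmono _ _ (mpp_exp hX hg) (mpp_exp hX hf) ?_) hSf
    filter_upwards [hfg, hXpos] with ω h1 h2
    gcongr
  · intro f g hf hg hSf hSg p q hp hq hpq
    rcases hp.eq_or_lt with rfl | hp
    · have : q = 1 := by linarith
      subst this
      simpa using hSg
    rcases hq.eq_or_lt with rfl | hq
    · have : p = 1 := by linarith
      subst this
      simpa using hSf
    have hq1 : q = 1 - p := by linarith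
    have mf := mpp_exp hX hf
    have mg := mpp_exp hX hg
    have hb : BddMeas P (fun ω => p * f ω + q * g ω) := by
      refine ⟨(hf.1.const_mul p).add (hg.1.const_mul q), ?_⟩
      obtain ⟨C, hC⟩ := hf.2
      obtain ⟨D, hD⟩ := hg.2
      refine ⟨p * C + q * D, ?_⟩
      filter_upwards [hC, hD] with ω h1 h2
      refine (abs_add_le _ _).trans ?_
      rw [abs_mul, abs_mul, abs_of_pos hp, abs_of_pos hq]
      gcongr
    have mm := mpp_exp hX hb
    have e : ∀ᵐ ω ∂P, X ω * Real.exp (-(p * f ω + q * g ω))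
        = (X ω * Real.exp (-f ω)) ^ p * (X ω * Real.exp (-g ω)) ^ (1 - p) := by
      filter_upwards [hXpos] with ω h
      rw [Real.mul_rpow h.le (Real.exp_pos _).le, Real.mul_rpow h.le (Real.exp_pos _).le,
        ← Real.exp_mul, ← Real.exp_mul]
      have h1 : X ω = X ω ^ p * X ω ^ (1 - p) := by
        rw [← Real.rpow_add h]; simp
      have h2 : Real.exp (-(p * f ω + q * g ω))
          = Real.exp (-f ω * p) * Real.exp (-g ω * (1 - p)) := by
        rw [← Real.exp_add, hq1]; congr 1; ring
      rw [h2]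
      nth_rewrite 1 [h1]
      ring
    have mm' := mpp_congr mm ((mf.1.pow_const p).mul (mg.1.pow_const (1 - p))) e
    have hp1 : 0 ≤ 1 - p := by linarith
    calc _ ≤ _ := hmono _ _ mm mm' (e.mono fun ω h => h.le)
      _ ≤ _ := hGG _ _ mf mg p ⟨hp, by linarith⟩
      _ ≤ t ^ p * t ^ (1 - p) := by
        have a1 := hpos _ mf
        have a2 := hpos _ mg
        gcongr
      _ = t := by rw [← Real.rpow_add ht]; simp
  · intro f fn C hf hfn hC hlim hSn
    have bfn : ∀ n, BddMeas P (fn n) := fun n => ⟨hfn n, C, hC n⟩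
    have hX' := hX
    obtain ⟨-, ⟨c, hc, h1⟩, D, h2⟩ := hX'
    have hF := hFatou (fun ω => X ω * Real.exp (-f ω)) (fun n ω => X ω * Real.exp (-fn n ω))
      (D * Real.exp C) (c * Real.exp (-C)) (by positivity) (mpp_exp hX hf)
      (fun n => mpp_exp hX (bfn n))
      (fun n => by
        filter_upwards [h1, h2, hC n] with ω a0 a b
        have h3 := (abs_le.1 b).1
        have h4 : 0 < X ω := hc.trans_le a0
        have h5 : 0 < D := h4.trans_le a
        rw [abs_of_nonneg (by positivity)]
        gcongr
        linarith)
      (fun n => by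
        filter_upwards [h1, hC n] with ω a b
        have h3 := (abs_le.1 b).2
        have h4 : 0 < X ω := hc.trans_le a
        gcongr)
      (by
        apply tendstoInMeasure_of_tendsto_ae
        · exact fun n => (mpp_exp hX (bfn n)).1.aestronglyMeasurable
        · filter_upwards [hlim] with ω h
          exact ((Real.continuous_exp.tendsto _).comp h.neg).const_mul _)
    refine hF.trans ?_
    exact liminf_le_of_frequently_le (Frequently.of_forall hSn)
      (isBoundedUnder_of ⟨0, fun n => (hpos _ (mpp_exp hX (bfn n))).le⟩)
  · intro f hf hfr hSf
    have h1 := hmono _ _ (mpp_exp hX (bc ((Real.log (ρ X) - Real.log t) / 2))) (mpp_exp hX hf) (by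
      filter_upwards [hfr, hXpos] with ω h1 h2
      gcongr)
    rw [hconst] at h1
    have h2 : Real.exp (-((Real.log (ρ X) - Real.log t) / 2)) * ρ X ≤ t := h1.trans hSf
    have h3 := Real.log_le_log (mul_pos (Real.exp_pos _) (ht.trans htX)) h2
    rw [Real.log_mul (Real.exp_pos _).ne' (ht.trans htX).ne', Real.log_exp] at h3
    linarith
  · refine ⟨Real.log (ρ X) - Real.log t, ?_⟩
    change ρ (fun ω => X ω * Real.exp (-(Real.log (ρ X) - Real.log t))) ≤ t
    rw [hconst, neg_sub, Real.exp_sub, Real.exp_log ht, Real.exp_log (ht.trans htX),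
      div_mul_cancel₀ _ (ht.trans htX).ne']


/-- dual representation of a geometrically convex return risk measure
with the lower-bounded Fatou property:
`ρ(X) = sup_{Q ≪ P} α(Q) exp(E_Q[log X])` where
`α(Q) = (sup_{Y ∈ B_ρ} exp(E_Q[log Y]))⁻¹` (with `(+∞)⁻¹ = 0`). -/
theorem ggConvexReturnRiskMeasure_dual_representation
    (P : Measure Ω) [IsProbabilityMeasure P] (ρ : (Ω → ℝ) → ℝ)
    (hmono : ∀ X Y : Ω → ℝ, MemLinftyPlusPlus P X → MemLinftyPlusPlus P Y →
      (∀ᵐ ω ∂P, X ω ≤ Y ω) → ρ X ≤ ρ Y)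
    (hhom : ∀ X : Ω → ℝ, MemLinftyPlusPlus P X → ∀ l : ℝ, 0 < l →
      ρ (fun ω => l * X ω) = l * ρ X)
    (hnorm : ρ (fun _ => (1 : ℝ)) = 1)
    (hpos : ∀ X : Ω → ℝ, MemLinftyPlusPlus P X → 0 < ρ X)
    (hGG : ∀ X Y : Ω → ℝ, MemLinftyPlusPlus P X → MemLinftyPlusPlus P Y →
      ∀ l ∈ Set.Ioo (0 : ℝ) 1,
        ρ (fun ω => X ω ^ l * Y ω ^ (1 - l)) ≤ ρ X ^ l * ρ Y ^ (1 - l))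
    (hFatou : ∀ (X : Ω → ℝ) (Xn : ℕ → Ω → ℝ) (k c : ℝ), 0 < c →
      MemLinftyPlusPlus P X → (∀ n, MemLinftyPlusPlus P (Xn n)) →
      (∀ n, ∀ᵐ ω ∂P, |Xn n ω| ≤ k) →
      (∀ n, ∀ᵐ ω ∂P, c ≤ Xn n ω) →
      TendstoInMeasure P Xn atTop X →
      ρ X ≤ atTop.liminf fun n => ρ (Xn n))
    (X : Ω → ℝ) (hX : MemLinftyPlusPlus P X) :
    ENNReal.ofReal (ρ X) =
      ⨆ (Q : Measure Ω) (_ : IsProbabilityMeasure Q) (_ : Q ≪ P),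
        (⨆ (Y : Ω → ℝ) (_ : MemLinftyPlusPlus P Y ∧ ρ Y ≤ 1),
            ENNReal.ofReal (Real.exp (∫ ω, Real.log (Y ω) ∂Q)))⁻¹ *
          ENNReal.ofReal (Real.exp (∫ ω, Real.log (X ω) ∂Q)) := by
  have hρX := hpos X hX
  apply le_antisymm
  · apply le_of_forall_lt
    intro s hs
    have hsne : s ≠ ⊤ := (hs.trans ENNReal.ofReal_lt_top).ne
    have hs' : s.toReal < ρ X := by
      rwa [← ENNReal.ofReal_toReal hsne, ENNReal.ofReal_lt_ofReal_iff hρX] at hs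
    obtain ⟨t, hst, htX⟩ := exists_between hs'
    have ht : 0 < t := ENNReal.toReal_nonneg.trans_lt hst
    have hst' : s < ENNReal.ofReal t := by
      rw [← ENNReal.ofReal_toReal hsne]
      exact (ENNReal.ofReal_lt_ofReal_iff ht).2 hst
    obtain ⟨Q, hQ, hQP, hQS⟩ := exists_prob
      (goodSet_of_riskMeasure P ρ hmono hhom hpos hGG hFatou X hX t ht htX)
    refine hst'.trans_le (le_iSup_of_le Q (le_iSup_of_le hQ (le_iSup_of_le hQP ?_)))
    have hsup : (⨆ (Y : Ω → ℝ) (_ : MemLinftyPlusPlus P Y ∧ ρ Y ≤ 1),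
            ENNReal.ofReal (Real.exp (∫ ω, Real.log (Y ω) ∂Q)))
        ≤ ENNReal.ofReal (Real.exp (∫ ω, Real.log (X ω) ∂Q) / t) := by
      refine iSup₂_le fun Y hY => ENNReal.ofReal_le_ofReal ?_
      have bX := bdd_log hX
      have bY := bdd_log hY.1
      have iX := bdd_integrable hQP bX
      have iY := bdd_integrable hQP bY
      have hb : BddMeas P (fun ω => Real.log (X ω) - Real.log (Y ω) - Real.log t) := by
        refine ⟨(bX.1.sub bY.1).sub measurable_const, ?_⟩
        obtain ⟨C, hC⟩ := bX.2
        obtain ⟨D, hD⟩ := bY.2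
        refine ⟨C + D + |Real.log t|, ?_⟩
        filter_upwards [hC, hD] with ω h1 h2
        refine (abs_sub _ _).trans ?_
        gcongr
        exact (abs_sub _ _).trans (add_le_add h1 h2)
      have h0 := hQS _ hb (by
        have mY : MemLinftyPlusPlus P (fun ω => t * Y ω) := by
          obtain ⟨hm, ⟨c, hc, h1⟩, C, h2⟩ := hY.1
          refine ⟨hm.const_mul t, ⟨t * c, by positivity, ?_⟩, t * C, ?_⟩
          · filter_upwards [h1] with ω h using mul_le_mul_of_nonneg_left h ht.le
          · filter_upwards [h2] with ω h using mul_le_mul_of_nonneg_left h ht.le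
        have h1 := hmono _ _ (mpp_exp hX hb) mY (by
          obtain ⟨-, ⟨c, hc, h1⟩, -⟩ := hX
          obtain ⟨-, ⟨d, hd, h2⟩, -⟩ := hY.1
          filter_upwards [h1, h2] with ω h3 h4
          have h5 := hc.trans_le h3
          have h6 := hd.trans_le h4
          have e : -(Real.log (X ω) - Real.log (Y ω) - Real.log t)
            = Real.log t + Real.log (Y ω) - Real.log (X ω) := by ring
          rw [e, Real.exp_sub, Real.exp_add, Real.exp_log ht, Real.exp_log h5, Real.exp_log h6]
          rw [mul_div_cancel₀ _ h5.ne'])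
        refine h1.trans ?_
        rw [hhom Y hY.1 t ht]
        exact mul_le_of_le_one_right ht.le hY.2)
      have iXY : Integrable (fun ω => Real.log (X ω) - Real.log (Y ω)) Q := iX.sub iY
      rw [integral_sub iXY (integrable_const _), integral_sub iX iY] at h0
      simp only [integral_const, probReal_univ, smul_eq_mul, one_mul] at h0
      rw [le_div_iff₀ ht]
      nth_rewrite 1 [← Real.exp_log ht]
      rw [← Real.exp_add]
      exact Real.exp_le_exp.2 (by linarith)
    calc ENNReal.ofReal t
        = (ENNReal.ofReal (Real.exp (∫ ω, Real.log (X ω) ∂Q) / t))⁻¹ *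
          ENNReal.ofReal (Real.exp (∫ ω, Real.log (X ω) ∂Q)) := by
          rw [← ENNReal.ofReal_inv_of_pos (by positivity), ← ENNReal.ofReal_mul (by positivity)]
          congr 1
          field_simp
      _ ≤ _ := by
          gcongr
  · refine iSup_le fun Q => iSup_le fun hQ => iSup_le fun hQP => ?_
    have mY : MemLinftyPlusPlus P (fun ω => (ρ X)⁻¹ * X ω) := by
      obtain ⟨hm, ⟨c, hc, h1⟩, C, h2⟩ := hX
      refine ⟨hm.const_mul _, ⟨(ρ X)⁻¹ * c, by positivity, ?_⟩, (ρ X)⁻¹ * C, ?_⟩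
      · filter_upwards [h1] with ω h using mul_le_mul_of_nonneg_left h (by positivity)
      · filter_upwards [h2] with ω h using mul_le_mul_of_nonneg_left h (by positivity)
    have rY : ρ (fun ω => (ρ X)⁻¹ * X ω) ≤ 1 := by
      rw [hhom X hX _ (by positivity), inv_mul_cancel₀ hρX.ne']
    have iX := bdd_integrable hQP (bdd_log hX)
    have e : ∫ ω, Real.log ((ρ X)⁻¹ * X ω) ∂Q = ∫ ω, Real.log (X ω) ∂Q - Real.log (ρ X) := by
      have : ∫ ω, Real.log ((ρ X)⁻¹ * X ω) ∂Q = ∫ ω, (Real.log (X ω) - Real.log (ρ X)) ∂Q := by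
        apply integral_congr_ae
        obtain ⟨-, ⟨c, hc, h1⟩, -⟩ := hX
        filter_upwards [hQP.ae_le h1] with ω h
        rw [Real.log_mul (by positivity) (hc.trans_le h).ne', Real.log_inv]
        ring
      rw [this, integral_sub iX (integrable_const _)]
      simp
    have hge := le_iSup₂_of_le (f := fun (Y : Ω → ℝ) (_ : MemLinftyPlusPlus P Y ∧ ρ Y ≤ 1) =>
      ENNReal.ofReal (Real.exp (∫ ω, Real.log (Y ω) ∂Q))) _ ⟨mY, rY⟩ le_rfl
    rw [e, Real.exp_sub, Real.exp_log hρX] at hge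
    calc _ ≤ (ENNReal.ofReal (Real.exp (∫ ω, Real.log (X ω) ∂Q) / ρ X))⁻¹ *
          ENNReal.ofReal (Real.exp (∫ ω, Real.log (X ω) ∂Q)) := by
          gcongr
      _ = ENNReal.ofReal (ρ X) := by
          rw [← ENNReal.ofReal_inv_of_pos (by positivity), ← ENNReal.ofReal_mul (by positivity)]
          congr 1
          field_simp
end
end
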